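/- arXiv:math/0405181 — 3 statements merged into one kernel-verified Lean document; each statement's English description precedes it below -/
import Mathlib

section
/- Let G be a finite positive graph. Then either H_G(r) equals the Kronecker delta δ_{0r} for all r, or there exist polynomials I_G and J_G such that H_G(r) = I_G(r) + (-1)^r J_G(r) for all nonnegative integers r. -/
open Finset

variable {V : Type*} [Fintype V] [DecidableEq V]

/-- A magic labeling of the finite graph with vertex set `V` and edge set `E`
(loops allowed), of magic sum `r`: for each vertex `v` the sum of the labels of
all edges incident to `v` (a loop counted once) equals `r`. -/
def IsMagic (E : Finset (Sym2 V)) (L : Sym2 V → ℕ) (r : ℕ) : Prop :=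
  (∀ e, e ∉ E → L e = 0) ∧ ∀ v : V, ∑ e ∈ E with v ∈ e, L e = r

/-- `HG E r` is the number of magic labelings of magic sum `r` of the graph with
edge set `E`. -/
noncomputable def HG (E : Finset (Sym2 V)) (r : ℕ) : ℕ :=
  Nat.card {L : Sym2 V → ℕ // IsMagic E L r}

/-- A positive graph: for every edge `e` there is a magic labeling `L` with `L e > 0`. -/
def IsPositive (E : Finset (Sym2 V)) : Prop :=
  ∀ e ∈ E, ∃ (L : Sym2 V → ℕ) (r : ℕ), IsMagic E L r ∧ 0 < L e

namespace Mg

def Q (u : ℕ → ℚ) : Prop := ∃ I J : Polynomial ℚ, ∀ n : ℕ, u n = I.eval (n : ℚ) + (-1) ^ n * J.eval (n : ℚ)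

lemma Q.zero : Q (fun _ => 0) := ⟨0, 0, by simp⟩

lemma Q.add {u v : ℕ → ℚ} (hu : Q u) (hv : Q v) : Q (fun n => u n + v n) := by
  obtain ⟨I, J, h⟩ := hu
  obtain ⟨I', J', h'⟩ := hv
  exact ⟨I + I', J + J', fun n => by simp [h, h']; ring⟩

lemma Q.sub {u v : ℕ → ℚ} (hu : Q u) (hv : Q v) : Q (fun n => u n - v n) := by
  obtain ⟨I, J, h⟩ := hu
  obtain ⟨I', J', h'⟩ := hv
  exact ⟨I - I', J - J', fun n => by simp [h, h']; ring⟩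

lemma Q.sum {ι : Type*} (s : Finset ι) (u : ι → ℕ → ℚ) (h : ∀ i ∈ s, Q (u i)) :
    Q (fun n => ∑ i ∈ s, u i n) := by
  classical
  induction s using Finset.induction_on with
  | empty => simpa using Q.zero
  | insert a s ha ih =>
    simp only [Finset.sum_insert ha]
    exact (h a (by simp)).add (ih fun i hi => h i (by simp [hi]))

lemma antidiff (p : Polynomial ℚ) : ∃ q : Polynomial ℚ, ∀ x : ℚ, q.eval (x + 1) - q.eval x = p.eval x := by
  induction p using Polynomial.induction_on' with
  | add p q hp hq =>
    obtain ⟨a, ha⟩ := hp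
    obtain ⟨b, hb⟩ := hq
    exact ⟨a + b, fun x => by simp [← ha, ← hb]; ring⟩
  | monomial k a =>
    refine ⟨Polynomial.C (a / (k + 1)) * Polynomial.bernoulli (k + 1), fun x => ?_⟩
    have := Polynomial.bernoulli_eval_one_add (k + 1) x
    rw [add_comm] at this
    have hk : (k : ℚ) + 1 ≠ 0 := by positivity
    simp [this]
    field_simp
    ring

lemma antidiff2 (p : Polynomial ℚ) : ∃ q : Polynomial ℚ, ∀ x : ℚ, q.eval (x + 2) - q.eval x = p.eval x := by
  obtain ⟨q, hq⟩ := antidiff (p.comp (2 * Polynomial.X))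
  refine ⟨q.comp (Polynomial.C (1/2) * Polynomial.X), fun x => ?_⟩
  have := hq (x / 2)
  simp at this ⊢
  rw [show (2:ℚ) * (x/2) = x by ring] at this
  rw [← this]
  congr 2 <;> ring_nf

lemma Q.of_diff {u : ℕ → ℚ} (h : Q (fun n => u (n + 2) - u n)) : Q u := by
  obtain ⟨I, J, h⟩ := h
  obtain ⟨I', hI⟩ := antidiff2 I
  obtain ⟨J', hJ⟩ := antidiff2 J
  have key : Q (fun n => u n - (I'.eval (n:ℚ) + (-1) ^ n * J'.eval (n:ℚ))) := by
    set v : ℕ → ℚ := fun n => u n - (I'.eval (n:ℚ) + (-1) ^ n * J'.eval (n:ℚ)) with hv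
    have hper : ∀ n, v (n + 2) = v n := by
      intro n
      have h1 := h n
      have h2 := hI n
      have h3 := hJ n
      simp only [hv]
      push_cast
      rw [pow_add]
      simp only [even_two, Even.neg_pow, one_pow, mul_one]
      linear_combination h1 - h2 - (-1)^n * h3
    refine ⟨Polynomial.C ((v 0 + v 1)/2), Polynomial.C ((v 0 - v 1)/2), fun n => ?_⟩
    simp only [Polynomial.eval_C]
    induction n using Nat.twoStepInduction with
    | zero => ring
    | one => ring
    | more n ih _ => rw [hper, ih]; ring
  have := key.add (⟨I', J', fun n => rfl⟩ : Q (fun n => I'.eval (n:ℚ) + (-1) ^ n * J'.eval (n:ℚ)))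
  simpa using this

lemma finA (T : Finset (Sym2 V)) (c : Sym2 V → ℚ) (r : ℚ) :
    {M : Sym2 V → ℚ | (∀ e, e ∉ T → M e = 0) ∧ (∀ e, 0 ≤ M e) ∧ (∀ e, ∃ z : ℤ, M e = c e + z) ∧
      ∀ v, ∑ e with v ∈ e, M e = r}.Finite := by
  have h1 : ∀ e : Sym2 V, {x : ℚ | 0 ≤ x ∧ x ≤ r ∧ ∃ z : ℤ, x = c e + z}.Finite := by
    intro e
    refine Set.Finite.subset ((Set.finite_Icc ⌊-c e⌋ ⌈r - c e⌉).image (fun z : ℤ => c e + z)) ?_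
    rintro x ⟨h0, h1, z, rfl⟩
    refine ⟨z, ⟨?_, ?_⟩, rfl⟩
    · have := Int.floor_le (-c e)
      have h : ((⌊-c e⌋ : ℤ) : ℚ) ≤ z := by linarith
      exact_mod_cast h
    · have := Int.le_ceil (r - c e)
      have h : (z : ℚ) ≤ ((⌈r - c e⌉ : ℤ) : ℚ) := by linarith
      exact_mod_cast h
  refine Set.Finite.subset (Set.Finite.pi' h1) ?_
  rintro M ⟨-, h0, hz, hs⟩ e
  refine ⟨h0 e, ?_, hz e⟩
  induction e using Sym2.ind with
  | _ a b =>
    rw [← hs a]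
    exact Finset.single_le_sum (f := M) (fun i _ => h0 i) (by simp)

noncomputable def A (T : Finset (Sym2 V)) (c : Sym2 V → ℚ) (r : ℚ) : Finset (Sym2 V → ℚ) :=
  (finA T c r).toFinset

lemma mem_A {T : Finset (Sym2 V)} {c : Sym2 V → ℚ} {r : ℚ} {M : Sym2 V → ℚ} : M ∈ A T c r ↔
    (∀ e, e ∉ T → M e = 0) ∧ (∀ e, 0 ≤ M e) ∧ (∀ e, ∃ z : ℤ, M e = c e + z) ∧
      ∀ v, ∑ e with v ∈ e, M e = r := by
  simp [A]

def supp (M : Sym2 V → ℚ) : Finset (Sym2 V) := {e | M e ≠ 0}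

noncomputable def B (T : Finset (Sym2 V)) (c : Sym2 V → ℚ) (r : ℚ) : Finset (Sym2 V → ℚ) :=
  {M ∈ A T c r | supp M = T}

lemma fiber (T S : Finset (Sym2 V)) (c : Sym2 V → ℚ) (r : ℚ) (h : S ⊆ T) :
    {M ∈ A T c r | supp M = S} = B S c r := by
  ext M
  simp only [B, Finset.mem_filter, mem_A]
  constructor
  · rintro ⟨⟨h1, h2⟩, rfl⟩
    exact ⟨⟨fun e he => by simpa [supp] using he, h2⟩, rfl⟩
  · rintro ⟨⟨h1, h2⟩, rfl⟩
    exact ⟨⟨fun e he => h1 e fun h' => he (h h'), h2⟩, rfl⟩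

lemma supp_sub {T : Finset (Sym2 V)} {c : Sym2 V → ℚ} {r : ℚ} {M : Sym2 V → ℚ} (h : M ∈ A T c r) :
    supp M ⊆ T := by
  intro e he
  by_contra h'
  simp [supp, (mem_A.1 h).1 e h'] at he

lemma card_A (T : Finset (Sym2 V)) (c : Sym2 V → ℚ) (r : ℚ) :
    Finset.card (A T c r) = ∑ S ∈ T.powerset, Finset.card (B S c r) := by
  rw [Finset.card_eq_sum_card_fiberwise (f := supp) (t := T.powerset)]
  · refine Finset.sum_congr rfl fun S hS => ?_
    rw [fiber T S c r (Finset.mem_powerset.1 hS)]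
  · intro M hM
    simpa using supp_sub hM

/-- boundary points w.r.t. w -/
noncomputable def G (T : Finset (Sym2 V)) (w : Sym2 V → ℕ) (c : Sym2 V → ℚ) (r : ℚ) :
    Finset (Sym2 V → ℚ) :=
  {M ∈ A T c r | ∃ e, 0 < w e ∧ M e = 0}

lemma card_G (T : Finset (Sym2 V)) (w : Sym2 V → ℕ) (c : Sym2 V → ℚ) (r : ℚ) :
    #(G T w c r) = ∑ S ∈ T.powerset with ∃ e, 0 < w e ∧ e ∉ S, Finset.card (B S c r) := by
  rw [Finset.card_eq_sum_card_fiberwise (f := supp)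
    (t := {S ∈ T.powerset | ∃ e, 0 < w e ∧ e ∉ S})]
  · refine Finset.sum_congr rfl fun S hS => ?_
    simp only [Finset.mem_filter, Finset.mem_powerset] at hS
    rw [← fiber T S c r hS.1, G, Finset.filter_filter]
    congr 1
    refine Finset.filter_congr fun M hM => ?_
    constructor
    · exact fun h => h.2
    · rintro rfl
      obtain ⟨_, e, he, he'⟩ := hS
      exact ⟨⟨e, he, by simpa [supp] using he'⟩, rfl⟩
  · intro M hM
    simp only [G, Finset.coe_filter, Set.mem_setOf_eq] at hM
    obtain ⟨hM, e, he, he'⟩ := hM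
    simp only [Finset.coe_filter, Set.mem_setOf_eq, Finset.mem_powerset]
    exact ⟨supp_sub hM, e, he, by simp [supp, he']⟩

lemma finLam (w : Sym2 V → ℕ) (c : Sym2 V → ℚ) :
    {l : ℚ | 0 ≤ l ∧ l < 1 ∧ ∃ e, 0 < w e ∧ ∃ z : ℤ, l * w e = c e + z}.Finite := by
  have : ∀ e : Sym2 V, {l : ℚ | 0 ≤ l ∧ l < 1 ∧ 0 < w e ∧ ∃ z : ℤ, l * w e = c e + z}.Finite := by
    intro e
    refine Set.Finite.subset ((Set.finite_Icc ⌊-c e⌋ ⌈w e - c e⌉).image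
      (fun z : ℤ => (c e + z) / w e)) ?_
    rintro l ⟨h0, h1, hw, z, hz⟩
    have hw' : (0 : ℚ) < w e := by exact_mod_cast hw
    refine ⟨z, ⟨?_, ?_⟩, ?_⟩
    · have := Int.floor_le (-c e)
      have h : ((⌊-c e⌋ : ℤ) : ℚ) ≤ z := by nlinarith
      exact_mod_cast h
    · have := Int.le_ceil (w e - c e)
      have h : (z : ℚ) ≤ ((⌈w e - c e⌉ : ℤ) : ℚ) := by nlinarith
      exact_mod_cast h
    · simp only [← hz]
      field_simp
  refine (Set.finite_iUnion this).subset ?_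
  rintro l ⟨h0, h1, e, he⟩
  exact Set.mem_iUnion.2 ⟨e, h0, h1, he⟩

noncomputable def Lam (w : Sym2 V → ℕ) (c : Sym2 V → ℚ) : Finset ℚ := (finLam w c).toFinset

lemma mem_Lam {w : Sym2 V → ℕ} {c : Sym2 V → ℚ} {l : ℚ} : l ∈ Lam w c ↔
    0 ≤ l ∧ l < 1 ∧ ∃ e, 0 < w e ∧ ∃ z : ℤ, l * w e = c e + z := by simp [Lam]

def IsW (T : Finset (Sym2 V)) (w : Sym2 V → ℕ) : Prop :=
  (∀ e, e ∉ T → w e = 0) ∧ ∀ v, ∑ e with v ∈ e, w e = 2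

lemma IsW.sumQ {T : Finset (Sym2 V)} {w : Sym2 V → ℕ} (h : IsW T w) (v : V) :
    ∑ e with v ∈ e, (w e : ℚ) = 2 := by exact_mod_cast h.2 v

lemma card_ge {T : Finset (Sym2 V)} {w : Sym2 V → ℕ} (hw : IsW T w) (c : Sym2 V → ℚ) (r : ℚ) :
    #{M ∈ A T c (r + 2) | ∀ e, (w e : ℚ) ≤ M e} = Finset.card (A T c r) := by
  refine Finset.card_bij' (fun M _ => fun e => M e - w e) (fun M _ => fun e => M e + w e) ?_ ?_ ?_ ?_
  · intro M hM
    simp only [Finset.mem_filter, mem_A] at hM ⊢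
    obtain ⟨⟨h1, h2, h3, h4⟩, h5⟩ := hM
    refine ⟨fun e he => by simp [h1 e he, hw.1 e he], fun e => by simpa using h5 e, fun e => ?_, fun v => ?_⟩
    · obtain ⟨z, hz⟩ := h3 e
      exact ⟨z - w e, by rw [hz]; push_cast; ring⟩
    · rw [Finset.sum_sub_distrib, h4, hw.sumQ]; ring
  · intro M hM
    simp only [Finset.mem_filter, mem_A] at hM ⊢
    obtain ⟨h1, h2, h3, h4⟩ := hM
    refine ⟨⟨fun e he => by simp [h1 e he, hw.1 e he], fun e => by have := h2 e; positivity, fun e => ?_, fun v => ?_⟩, fun e => by simpa using h2 e⟩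
    · obtain ⟨z, hz⟩ := h3 e
      exact ⟨z + w e, by rw [hz]; push_cast; ring⟩
    · rw [Finset.sum_add_distrib, h4, hw.sumQ]
  · intro M _; simp
  · intro M _; simp

lemma card_lt {T : Finset (Sym2 V)} {w : Sym2 V → ℕ} (hw : IsW T w) (c : Sym2 V → ℚ) (r : ℚ) :
    #{M ∈ A T c r | ¬ ∀ e, (w e : ℚ) ≤ M e} =
      ∑ l ∈ Lam w c, #(G T w (fun e => c e - l * w e) (r - 2 * l)) := by
  rw [← Finset.card_sigma]
  symm
  refine Finset.card_bij (fun p _ => fun e => p.2 e + p.1 * w e) ?_ ?_ ?_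
  · rintro ⟨l, N⟩ h
    simp only [Finset.mem_sigma, G, Finset.mem_filter, mem_A, mem_Lam] at h ⊢
    obtain ⟨⟨hl0, hl1, -⟩, ⟨h1, h2, h3, h4⟩, e, he, hNe⟩ := h
    refine ⟨⟨fun e he => by simp [h1 e he, hw.1 e he], fun e => by have := h2 e; positivity, fun e => ?_, fun v => ?_⟩, ?_⟩
    · obtain ⟨z, hz⟩ := h3 e
      exact ⟨z, by rw [hz]; ring⟩
    · rw [Finset.sum_add_distrib, h4, ← Finset.mul_sum, hw.sumQ]; ring
    · push Not
      refine ⟨e, ?_⟩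
      have : (0:ℚ) < w e := by exact_mod_cast he
      rw [hNe]; nlinarith
  · rintro ⟨l, N⟩ h ⟨l', N'⟩ h' heq
    simp only [Finset.mem_sigma, G, Finset.mem_filter, mem_A] at h h'
    obtain ⟨-, ⟨-, h2, -⟩, e, he, hNe⟩ := h
    obtain ⟨-, ⟨-, h2', -⟩, e', he', hNe'⟩ := h'
    have q := congrFun heq e
    have q' := congrFun heq e'
    simp only [hNe, hNe'] at q q'
    have p : (0:ℚ) < w e := by exact_mod_cast he
    have p' : (0:ℚ) < w e' := by exact_mod_cast he'
    have a1 : l' ≤ l := by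
      have := h2' e
      by_contra hc
      push Not at hc
      nlinarith
    have a2 : l ≤ l' := by
      have := h2 e'
      by_contra hc
      push Not at hc
      nlinarith
    obtain rfl := le_antisymm a1 a2
    have : N = N' := by
      funext x
      have := congrFun heq x
      simpa using this
    rw [this]
  · intro M hM
    simp only [Finset.mem_filter, mem_A] at hM
    obtain ⟨⟨h1, h2, h3, h4⟩, h5⟩ := hM
    push Not at h5
    obtain ⟨e0, he0⟩ := h5
    have hpos0 : 0 < w e0 := by
      have := h2 e0
      have : (0:ℚ) < w e0 := by linarith
      exact_mod_cast this
    obtain ⟨e, he, hmin⟩ := Finset.exists_min_image {e : Sym2 V | 0 < w e} (fun e => M e / w e)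
      ⟨e0, by simpa using hpos0⟩
    simp only [Finset.mem_filter, Finset.mem_univ, true_and] at he hmin
    have p : (0:ℚ) < w e := by exact_mod_cast he
    have p0 : (0:ℚ) < w e0 := by exact_mod_cast hpos0
    set l := M e / w e with hl
    have hle : l * w e = M e := by rw [hl]; field_simp
    refine ⟨⟨l, fun x => M x - l * w x⟩, ?_, by simp⟩
    simp only [Finset.mem_sigma, G, Finset.mem_filter, mem_A, mem_Lam]
    refine ⟨⟨div_nonneg (h2 e) p.le, ?_, e, he, ?_⟩, ⟨fun x hx => by simp [h1 x hx, hw.1 x hx], fun x => ?_, fun x => ?_, fun v => ?_⟩, e, he, by rw [hle]; ring⟩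
    · exact (hmin e0 hpos0).trans_lt ((div_lt_one p0).2 he0)
    · rw [hle]; exact h3 e
    · rcases Nat.eq_zero_or_pos (w x) with hx | hx
      · simpa [hx] using h2 x
      · have px : (0:ℚ) < w x := by exact_mod_cast hx
        have := hmin x hx
        rw [le_div_iff₀ px] at this
        linarith
    · obtain ⟨z, hz⟩ := h3 x
      exact ⟨z, by rw [hz]; ring⟩
    · rw [Finset.sum_sub_distrib, h4, ← Finset.mul_sum, hw.sumQ]; ring

lemma sum_inc (M : Sym2 V → ℚ) (v : V) : ∑ e with v ∈ e, M e = ∑ u, M s(v, u) := by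
  symm
  refine Finset.sum_bij (fun u _ => s(v, u)) ?_ ?_ ?_ ?_
  · simp
  · intro a _ b _ h
    simp only [Sym2.eq_iff] at h
    grind
  · intro e he
    simp only [Finset.mem_filter, Finset.mem_univ, true_and] at he
    obtain ⟨u, rfl⟩ := he
    exact ⟨u, by simp, rfl⟩
  · simp

lemma exists_W {T : Finset (Sym2 V)} {c : Sym2 V → ℚ} {r : ℚ} (hr : 0 < r) {M : Sym2 V → ℚ}
    (hM : M ∈ A T c r) : ∃ w, IsW T w := by
  obtain ⟨h1, h2, -, h4⟩ := mem_A.1 hM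
  simp only [sum_inc] at h4
  have hall := (Finset.all_card_le_biUnion_card_iff_exists_injective
    (fun v : V => ({u | 0 < M s(v, u)} : Finset V))).1 (by
      intro S
      set N := S.biUnion (fun v : V => ({u | 0 < M s(v, u)} : Finset V)) with hN
      have e1 : ∑ v ∈ S, ∑ u, M s(v, u) = #S * r := by simp [h4]
      have e2 : ∑ u ∈ N, ∑ v, M s(u, v) = #N * r := by simp [h4]
      have e3 : ∑ v ∈ S, ∑ u, M s(v, u) = ∑ v ∈ S, ∑ u ∈ N, M s(v, u) := by
        refine Finset.sum_congr rfl fun v hv => ?_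
        symm
        refine Finset.sum_subset (Finset.subset_univ _) fun u _ hu => ?_
        by_contra hne
        refine hu (Finset.mem_biUnion.2 ⟨v, hv, ?_⟩)
        simpa using lt_of_le_of_ne (h2 _) (Ne.symm hne)
      have e4 : ∑ v ∈ S, ∑ u ∈ N, M s(v, u) ≤ ∑ u ∈ N, ∑ v, M s(u, v) := by
        rw [Finset.sum_comm]
        refine Finset.sum_le_sum fun u _ => ?_
        simp only [Sym2.eq_swap (a := _) (b := u)]
        exact Finset.sum_le_sum_of_subset_of_nonneg (Finset.subset_univ _) fun i _ _ => h2 _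
      have : (#S : ℚ) * r ≤ #N * r := by rw [← e1, ← e2, e3]; exact e4
      have := le_of_mul_le_mul_right this hr
      exact_mod_cast this)
  obtain ⟨f, hf, hf'⟩ := hall
  have hbij : Function.Bijective f := Finite.injective_iff_bijective.1 hf
  refine ⟨fun e => ∑ u : V, if s(u, f u) = e then (if f u = u then 2 else 1) else 0, ?_, ?_⟩
  · intro e he
    refine Finset.sum_eq_zero fun u _ => ?_
    rw [if_neg]
    rintro rfl
    have := hf' u
    simp [h1 _ he] at this
  · intro v
    rw [Finset.sum_comm]
    have : ∀ u : V, (∑ e with v ∈ e, if s(u, f u) = e then (if f u = u then 2 else 1) else 0)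
        = (if u = v then 1 else 0) + (if f u = v then 1 else 0) := by
      intro u
      rw [Finset.sum_ite_eq]
      simp only [Finset.mem_filter, Finset.mem_univ, true_and, Sym2.mem_iff]
      by_cases h1 : u = v <;> by_cases h2 : f u = v <;> by_cases h3 : f u = u <;> grind
    simp only [this, Finset.sum_add_distrib]
    obtain ⟨u0, hu0⟩ := hbij.2 v
    have : ∀ u, f u = v ↔ u = u0 := fun u => by rw [← hu0]; exact hf.eq_iff
    simp [this]

lemma stepA (T : Finset (Sym2 V)) (ih : ∀ S, S ⊂ T → ∀ c ρ, 0 < ρ → Q (fun n => Finset.card (B S c (ρ + n))))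
    {w : Sym2 V → ℕ} (hw : IsW T w) (c : Sym2 V → ℚ) (ρ : ℚ) (hρ : 0 ≤ ρ) :
    Q (fun n => Finset.card (A T c (ρ + n))) := by
  apply Q.of_diff
  have : ∀ n : ℕ, (Finset.card (A T c (ρ + (n + 2 : ℕ))) : ℚ) - Finset.card (A T c (ρ + n)) =
      ∑ l ∈ Lam w c, ∑ S ∈ T.powerset with ∃ e, 0 < w e ∧ e ∉ S,
        (Finset.card (B S (fun e => c e - l * w e) ((ρ + 2 - 2 * l) + n)) : ℚ) := by
    intro n
    rw [show ρ + (n + 2 : ℕ) = ρ + n + 2 by push_cast; ring]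
    rw [← Finset.card_filter_add_card_filter_not (s := A T c (ρ + n + 2)) (fun M => ∀ e, (w e : ℚ) ≤ M e),
      card_ge hw, card_lt hw]
    push_cast
    rw [add_sub_cancel_left]
    refine Finset.sum_congr rfl fun l _ => ?_
    rw [card_G]
    push_cast
    refine Finset.sum_congr rfl fun S _ => ?_
    rw [show ρ + n + 2 - 2 * l = ρ + 2 - 2 * l + n by ring]
  simp only [this]
  refine Q.sum _ _ fun l hl => Q.sum _ _ fun S hS => ?_
  have hl := (mem_Lam.1 hl).2.1
  simp only [Finset.mem_filter, Finset.mem_powerset] at hS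
  obtain ⟨hS, e, he, heS⟩ := hS
  refine ih S (lt_of_le_of_ne hS ?_) _ _ (by linarith)
  rintro rfl
  rw [hw.1 e heS] at he
  exact lt_irrefl _ he

lemma mainB (T : Finset (Sym2 V)) : ∀ c ρ, 0 < ρ → Q (fun n => Finset.card (B T c (ρ + n))) := by
  induction T using Finset.strongInduction with
  | H T ih =>
    intro c ρ hρ
    have hA : Q (fun n => Finset.card (A T c (ρ + n))) := by
      by_cases hw : ∃ w, IsW T w
      · obtain ⟨w, hw⟩ := hw
        exact stepA T ih hw c ρ hρ.le
      · have : ∀ n : ℕ, A T c (ρ + n) = ∅ := by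
          intro n
          refine Finset.eq_empty_of_forall_notMem fun M hM => hw (exists_W (by positivity) hM)
        simpa [this] using Q.zero
    have := hA.sub (Q.sum T.ssubsets (fun S n => (Finset.card (B S c (ρ + n)) : ℚ))
      fun S hS => ih S (Finset.mem_ssubsets.1 hS) c ρ hρ)
    convert this using 2 with n
    rw [card_A, Finset.ssubsets, ← Finset.sum_erase_add _ _ (Finset.mem_powerset_self T)]
    push_cast
    ring

lemma HG_eq (E : Finset (Sym2 V)) (r : ℕ) : HG E r = Finset.card (A E 0 r) := by
  rw [HG, ← Nat.card_eq_finsetCard]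
  have hsum : ∀ (L : Sym2 V → ℕ), (∀ e, e ∉ E → L e = 0) → ∀ v : V,
      ∑ e ∈ E with v ∈ e, L e = ∑ e with v ∈ e, L e := by
    intro L hL v
    refine Finset.sum_subset (Finset.filter_subset_filter _ (Finset.subset_univ _)) fun e he he' => ?_
    apply hL
    intro h
    simp only [Finset.mem_filter, Finset.mem_univ, true_and] at he he'
    exact he' ⟨h, he⟩
  refine Nat.card_eq_of_bijective (fun L => ⟨fun e => (L.1 e : ℚ), ?_⟩) ⟨?_, ?_⟩
  · obtain ⟨L, h1, h2⟩ := L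
    rw [mem_A]
    refine ⟨fun e he => by simp [h1 e he], fun e => by simp, fun e => ⟨L e, by simp⟩, fun v => ?_⟩
    have := h2 v
    rw [hsum L h1] at this
    exact_mod_cast this
  · rintro ⟨L, hL⟩ ⟨L', hL'⟩ h
    simp only [Subtype.mk.injEq] at h ⊢
    funext e
    exact_mod_cast congrFun h e
  · rintro ⟨M, hM⟩
    obtain ⟨h1, h2, h3, h4⟩ := mem_A.1 hM
    have : ∀ e, ∃ k : ℕ, M e = k := by
      intro e
      obtain ⟨z, hz⟩ := h3 e
      have h0 := h2 e
      simp only [Pi.zero_apply, zero_add] at hz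
      rw [hz] at h0 ⊢
      have h0' : 0 ≤ z := by exact_mod_cast h0
      lift z to ℕ using h0'
      exact ⟨z, by simp⟩
    choose L hL using this
    have hL0 : ∀ e, e ∉ E → L e = 0 := by
      intro e he
      have := h1 e he
      rw [hL] at this
      exact_mod_cast this
    refine ⟨⟨L, hL0, fun v => ?_⟩, ?_⟩
    · rw [hsum L hL0]
      have := h4 v
      simp only [hL] at this
      exact_mod_cast this
    · simp only [Subtype.mk.injEq]
      funext e
      exact (hL e).symm

end Mg

/-- Let `G` be a finite positive graph. Then either `H_G(r)` is the Kronecker delta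
`δ_{0r}`, or there exist polynomials `I_G` and `J_G` such that
`H_G(r) = I_G(r) + (-1)^r J_G(r)` for all nonnegative integers `r`. -/
theorem magic_quasipolynomial (E : Finset (Sym2 V)) (hpos : IsPositive E) :
    (∀ r : ℕ, HG E r = if r = 0 then 1 else 0) ∨
    ∃ I J : Polynomial ℚ, ∀ r : ℕ,
      (HG E r : ℚ) = I.eval (r : ℚ) + (-1) ^ r * J.eval (r : ℚ) := by
  by_cases hw : ∃ w, Mg.IsW E w
  · right
    obtain ⟨w, hw⟩ := hw
    have := Mg.stepA E (fun S _ => Mg.mainB S) hw 0 0 le_rfl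
    simpa [Mg.HG_eq, Mg.Q] using this
  · left
    intro r
    rw [Mg.HG_eq]
    split_ifs with h
    · subst h
      rw [Finset.card_eq_one]
      refine ⟨0, ?_⟩
      ext M
      rw [Mg.mem_A, Finset.mem_singleton]
      constructor
      · rintro ⟨-, h2, -, h4⟩
        funext e
        induction e using Sym2.ind with
        | _ a b =>
          refine le_antisymm ?_ (h2 _)
          have := h4 a
          simp only [Nat.cast_zero] at this
          rw [Pi.zero_apply, ← this]
          exact Finset.single_le_sum (f := M) (fun i _ => h2 i) (by simp)
      · rintro rfl
        exact ⟨by simp, by simp, fun e => ⟨0, by simp⟩, by simp⟩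
    · rw [Finset.card_eq_zero]
      exact Finset.eq_empty_of_forall_notMem fun M hM => hw (Mg.exists_W (by positivity) hM)
end

section
/- Let G be a finite positive graph with at least one edge. Then H_G(r), as a quasi-polynomial in r, has degree q - n + b, where q is the number of edges of G, n is the number of vertices, and b is the number of connected components of G which are bipartite. -/
open Finset

variable {V : Type*} [Fintype V] [DecidableEq V]

/-- The simple graph recording which vertices are joined by an edge of `E`,
used only to define connected components (loops are irrelevant for connectivity). -/
def compGraph (E : Finset (Sym2 V)) : SimpleGraph V :=
  SimpleGraph.fromRel (fun u v => s(u, v) ∈ E)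

/-- The number of connected components of the graph with edge set `E` that are
bipartite: components whose vertices can be 2-colored so that every edge of `E`
inside the component joins the two color classes (in particular, components
containing a loop are not bipartite). -/
noncomputable def numBipComp (E : Finset (Sym2 V)) : ℕ :=
  Nat.card {C : (compGraph E).ConnectedComponent //
    ∃ c : V → Bool, ∀ u v : V, s(u, v) ∈ E →
      (compGraph E).connectedComponentMk u = C → c u ≠ c v}


/-- Sequences given by a polynomial. -/
def PolySeq (f : ℕ → ℚ) : Prop := ∃ p : Polynomial ℚ, ∀ k : ℕ, f k = p.eval (k : ℚ)

lemma PolySeq.add {f g : ℕ → ℚ} (hf : PolySeq f) (hg : PolySeq g) :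
    PolySeq (fun k => f k + g k) := by
  obtain ⟨p, hp⟩ := hf
  obtain ⟨q, hq⟩ := hg
  exact ⟨p + q, fun k => by simp [hp, hq]⟩

lemma PolySeq.sub {f g : ℕ → ℚ} (hf : PolySeq f) (hg : PolySeq g) :
    PolySeq (fun k => f k - g k) := by
  obtain ⟨p, hp⟩ := hf
  obtain ⟨q, hq⟩ := hg
  exact ⟨p - q, fun k => by simp [hp, hq]⟩

lemma PolySeq.zero : PolySeq (fun _ => 0) := ⟨0, by simp⟩

lemma PolySeq.sum {ι : Type*} (s : Finset ι) {f : ι → ℕ → ℚ} (h : ∀ i ∈ s, PolySeq (f i)) :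
    PolySeq (fun k => ∑ i ∈ s, f i k) := by
  classical
  induction s using Finset.induction_on with
  | empty => simpa using PolySeq.zero
  | insert a s ha ih =>
    simp only [Finset.sum_insert ha]
    exact (h a (by simp)).add (ih fun i hi => h i (by simp [hi]))

lemma exists_antidiff (p : Polynomial ℚ) :
    ∃ q : Polynomial ℚ, ∀ x : ℚ, q.eval (x + 1) - q.eval x = p.eval x := by
  induction p using Polynomial.induction_on' with
  | add p q hp hq =>
    obtain ⟨a, ha⟩ := hp
    obtain ⟨b, hb⟩ := hq
    refine ⟨a + b, fun x => ?_⟩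
    simp only [Polynomial.eval_add, ← ha, ← hb]
    ring
  | monomial n a =>
    refine ⟨Polynomial.C (a / (n + 1)) * Polynomial.bernoulli (n + 1), fun x => ?_⟩
    have h := Polynomial.bernoulli_eval_one_add (n + 1) x
    rw [add_comm x 1]
    simp only [Polynomial.eval_mul, Polynomial.eval_C, h, Polynomial.eval_monomial]
    have : (n : ℚ) + 1 ≠ 0 := by positivity
    push_cast
    field_simp
    ring

lemma PolySeq.of_diff {f : ℕ → ℚ} (h : PolySeq (fun k => f (k + 1) - f k)) : PolySeq f := by
  obtain ⟨p, hp⟩ := h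
  obtain ⟨q, hq⟩ := exists_antidiff p
  refine ⟨q + Polynomial.C (f 0 - q.eval 0), fun k => ?_⟩
  induction k with
  | zero => simp
  | succ k ih =>
    have h1 := hp k
    have h2 := hq k
    simp only [Polynomial.eval_add, Polynomial.eval_C] at ih ⊢
    push_cast
    linarith

lemma sum_star (y : Sym2 V → ℚ) (v : V) :
    ∑ e with v ∈ e, y e = ∑ u, y s(v, u) := by
  have : (Finset.univ.filter (fun e : Sym2 V => v ∈ e)) =
      Finset.univ.image (fun u => s(v, u)) := by
    ext e
    simp [Sym2.mem_iff_exists, eq_comm]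
  rw [this, Finset.sum_image]
  intro a _ b _ h
  exact Sym2.congr_right.1 h

/-- Nonnegative rational labelings in a coset of the integer lattice. -/
def SolSet (E : Finset (Sym2 V)) (α : Sym2 V → ℚ) (r : ℚ) : Set (Sym2 V → ℚ) :=
  {y | (∀ e, 0 ≤ y e) ∧ (∀ e, e ∉ E → y e = 0) ∧ (∀ e, ∃ n : ℤ, y e - α e = n) ∧
    ∀ v : V, ∑ e with v ∈ e, y e = r}

lemma SolSet.le {E : Finset (Sym2 V)} {α : Sym2 V → ℚ} {r : ℚ} {y : Sym2 V → ℚ}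
    (hy : y ∈ SolSet E α r) (e : Sym2 V) : y e ≤ r := by
  obtain ⟨h0, -, -, h3⟩ := hy
  induction e with
  | _ u v =>
    rw [← h3 u]
    exact Finset.single_le_sum (f := y) (fun e _ => h0 e) (by simp)

lemma SolSet.finite (E : Finset (Sym2 V)) (α : Sym2 V → ℚ) (r : ℚ) :
    (SolSet E α r).Finite := by
  have hfin : (Set.pi Set.univ (fun e : Sym2 V =>
      (fun n : ℤ => α e + n) '' (Set.Icc ⌊- α e⌋ ⌈r - α e⌉))).Finite :=
    Set.Finite.pi fun e => (Set.finite_Icc _ _).image _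
  refine hfin.subset fun y hy e _ => ?_
  obtain ⟨n, hn⟩ := hy.2.2.1 e
  refine ⟨n, ⟨?_, ?_⟩, by simp only; linarith⟩
  · have : (⌊-α e⌋ : ℚ) ≤ n := (Int.floor_le _).trans (by linarith [hy.1 e])
    exact_mod_cast this
  · have : (n : ℚ) ≤ ⌈r - α e⌉ := le_trans (by linarith [SolSet.le hy e]) (Int.le_ceil _)
    exact_mod_cast this

lemma exists_two_factor {E : Finset (Sym2 V)} {α : Sym2 V → ℚ} {r : ℚ} (hr : 0 < r)
    {y : Sym2 V → ℚ} (hy : y ∈ SolSet E α r) :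
    ∃ L : Sym2 V → ℕ, (∀ e, e ∉ E → L e = 0) ∧ ∀ v : V, ∑ e with v ∈ e, (L e : ℚ) = 2 := by
  obtain ⟨h0, h1, -, h3⟩ := hy
  have hrow : ∀ v, ∑ u, y s(v, u) = r := fun v => by rw [← sum_star, h3]
  let M : Matrix V V ℚ := fun u v => y s(u, v) / r
  have hM : M ∈ doublyStochastic ℚ V := by
    rw [mem_doublyStochastic_iff_sum]
    refine ⟨fun i j => div_nonneg (h0 _) hr.le, fun i => ?_, fun j => ?_⟩
    · simp only [M]
      rw [← Finset.sum_div, hrow, div_self hr.ne']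
    · simp only [M, Sym2.eq_swap (b := j)]
      rw [← Finset.sum_div, hrow, div_self hr.ne']
  obtain ⟨w, hw0, hw1, hwM⟩ := exists_eq_sum_perm_of_mem_doublyStochastic hM
  have : ∃ σ, w σ ≠ 0 := by
    by_contra! h
    simp [h] at hw1
  obtain ⟨σ, hσ⟩ := this
  have hpos : ∀ u, 0 < y s(u, σ u) := by
    intro u
    have h4 : M u (σ u) = ∑ τ, w τ * (τ.permMatrix ℚ) u (σ u) := by
      rw [← hwM, Matrix.sum_apply]
      simp
    have h5 : w σ * (σ.permMatrix ℚ) u (σ u) ≤ M u (σ u) := by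
      rw [h4]
      refine Finset.single_le_sum (f := fun τ => w τ * (Equiv.Perm.permMatrix ℚ τ) u (σ u))
        (fun τ _ => mul_nonneg (hw0 τ) ?_) (Finset.mem_univ σ)
      simp only [PEquiv.toMatrix_apply]
      split_ifs <;> simp
    have h6 : (σ.permMatrix ℚ) u (σ u) = 1 := by simp [PEquiv.toMatrix_apply, Equiv.toPEquiv_apply]
    rw [h6, mul_one] at h5
    have h7 : 0 < M u (σ u) := lt_of_lt_of_le (lt_of_le_of_ne (hw0 σ) hσ.symm) h5
    exact (div_pos_iff_of_pos_right hr).1 h7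
  let L : Sym2 V → ℕ := Sym2.lift ⟨fun u v => (if σ u = v then 1 else 0) + (if σ v = u then 1 else 0),
    fun u v => add_comm _ _⟩
  refine ⟨L, ?_, fun v => ?_⟩
  · intro e he
    induction e with
    | _ u v =>
      have hz := h1 _ he
      simp only [L, Sym2.lift_mk]
      have a1 : σ u ≠ v := by
        rintro rfl
        exact (hpos u).ne' hz
      have a2 : σ v ≠ u := by
        rintro rfl
        rw [Sym2.eq_swap] at hz
        exact (hpos v).ne' hz
      simp [a1, a2]
  · rw [sum_star (fun e => (L e : ℚ))]
    simp only [L, Sym2.lift_mk]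
    push_cast
    rw [Finset.sum_add_distrib]
    have : ∀ x, σ x = v ↔ x = σ.symm v := fun x => by rw [Equiv.eq_symm_apply]
    simp [this]
    norm_num

/-- Solutions vanishing somewhere on `S`. -/
def ZSet (E S : Finset (Sym2 V)) (α : Sym2 V → ℚ) (r : ℚ) : Set (Sym2 V → ℚ) :=
  {y | y ∈ SolSet E α r ∧ ∃ e ∈ S, y e = 0}

lemma ZSet.finite (E S : Finset (Sym2 V)) (α : Sym2 V → ℚ) (r : ℚ) :
    (ZSet E S α r).Finite := (SolSet.finite E α r).subset fun _ h => h.1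

lemma mem_SolSet_erase {E : Finset (Sym2 V)} {a : Sym2 V} {α : Sym2 V → ℚ} {r : ℚ}
    {y : Sym2 V → ℚ} : y ∈ SolSet (E.erase a) α r ↔ y ∈ SolSet E α r ∧ y a = 0 := by
  constructor
  · rintro ⟨h0, h1, h2, h3⟩
    refine ⟨⟨h0, fun e he => h1 e (by simp [he]), h2, h3⟩, h1 a (by simp)⟩
  · rintro ⟨⟨h0, h1, h2, h3⟩, ha⟩
    refine ⟨h0, fun e he => ?_, h2, h3⟩
    by_cases h : e = a
    · rw [h, ha]
    · exact h1 e fun h' => he (by simp [h, h'])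

/-- The counting function is polynomial on residue classes, for positive sums. -/
def GoodEdges (E : Finset (Sym2 V)) : Prop :=
  ∀ (α : Sym2 V → ℚ) (ρ : ℚ), 0 < ρ →
    PolySeq (fun k => ((SolSet E α (ρ + 2 * k)).ncard : ℚ))

lemma zset_poly (S : Finset (Sym2 V)) : ∀ E : Finset (Sym2 V), S ⊆ E →
    (∀ E', E' ⊂ E → GoodEdges E') → ∀ (α : Sym2 V → ℚ) (ρ : ℚ), 0 < ρ →
    PolySeq (fun k => ((ZSet E S α (ρ + 2 * k)).ncard : ℚ)) := by
  induction S using Finset.induction_on with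
  | empty =>
    intro E _ _ α ρ _
    have : ∀ r, ZSet E ∅ α r = ∅ := fun r => by ext; simp [ZSet]
    simpa [this] using PolySeq.zero
  | insert a S ha ih =>
    intro E hS hE α ρ hρ
    have haE : a ∈ E := hS (by simp)
    have hSE : S ⊆ E := fun x hx => hS (by simp [hx])
    have hss : E.erase a ⊂ E := Finset.erase_ssubset haE
    have h1 := hE _ hss α ρ hρ
    have h2 := ih E hSE hE α ρ hρ
    have h3 := ih (E.erase a) (fun x hx => Finset.mem_erase.2
      ⟨fun h => ha (h ▸ hx), hSE hx⟩) (fun E' h' => hE E' (h'.trans hss)) α ρ hρ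
    convert (h1.add h2).sub h3 using 2 with k
    have hU : ZSet E (insert a S) α (ρ + 2 * k) =
        SolSet (E.erase a) α (ρ + 2 * k) ∪ ZSet E S α (ρ + 2 * k) := by
      ext y
      simp only [ZSet, Set.mem_union, mem_SolSet_erase, Set.mem_ofPred_eq, Finset.mem_insert,
        exists_eq_or_imp]
      tauto
    have hI : ZSet (E.erase a) S α (ρ + 2 * k) =
        SolSet (E.erase a) α (ρ + 2 * k) ∩ ZSet E S α (ρ + 2 * k) := by
      ext y
      simp only [ZSet, Set.mem_inter_iff, mem_SolSet_erase, Set.mem_ofPred_eq]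
      tauto
    have := Set.ncard_union_add_ncard_inter (SolSet (E.erase a) α (ρ + 2 * k))
      (ZSet E S α (ρ + 2 * k)) (SolSet.finite _ _ _) (ZSet.finite _ _ _ _)
    rw [← hU, ← hI] at this
    rw [eq_sub_iff_add_eq]
    exact_mod_cast this

lemma shift_ncard {E : Finset (Sym2 V)} {L : Sym2 V → ℕ} (hL0 : ∀ e, e ∉ E → L e = 0)
    (hL2 : ∀ v : V, ∑ e with v ∈ e, (L e : ℚ) = 2) (α : Sym2 V → ℚ) (r t : ℚ) (ht : 0 ≤ t)
    (P : (Sym2 V → ℚ) → Prop) :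
    {y | y ∈ SolSet E α r ∧ (∀ e, t * L e ≤ y e) ∧ P (fun e => y e - t * L e)}.ncard =
    {y | y ∈ SolSet E (fun e => α e - t * L e) (r - 2 * t) ∧ P y}.ncard := by
  have hsum : ∀ v : V, ∑ e with v ∈ e, t * (L e : ℚ) = 2 * t := fun v => by
    rw [← Finset.mul_sum, hL2, mul_comm]
  symm
  rw [← Set.ncard_image_of_injective (f := fun y : Sym2 V → ℚ => fun e => y e + t * L e)]
  · congr 1
    symm
    ext y
    simp only [Set.mem_ofPred_eq, Set.mem_image]
    constructor
    · rintro ⟨⟨h0, h1, h2, h3⟩, h4, h5⟩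
      refine ⟨fun e => y e - t * L e, ⟨⟨fun e => sub_nonneg.2 (h4 e), fun e he => ?_,
        fun e => ?_, fun v => ?_⟩, h5⟩, by simp⟩
      · simp [h1 e he, hL0 e he]
      · obtain ⟨n, hn⟩ := h2 e
        exact ⟨n, by simpa using hn⟩
      · rw [Finset.sum_sub_distrib, h3, hsum]
    · rintro ⟨z, ⟨⟨h0, h1, h2, h3⟩, h5⟩, rfl⟩
      refine ⟨⟨fun e => ?_, fun e he => ?_, fun e => ?_, fun v => ?_⟩, fun e => ?_, ?_⟩
      · have := h0 e
        positivity
      · simp [h1 e he, hL0 e he]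
      · obtain ⟨n, hn⟩ := h2 e
        exact ⟨n, by rw [← hn]; ring⟩
      · rw [Finset.sum_add_distrib, h3, hsum]
        ring
      · linarith [h0 e]
      · simpa using h5
  · intro y z h
    ext e
    simpa using congrFun h e

lemma SolSet_sub_int (E : Finset (Sym2 V)) (α : Sym2 V → ℚ) (r : ℚ) (L : Sym2 V → ℕ) :
    SolSet E (fun e => α e - 1 * L e) r = SolSet E α r := by
  ext y
  simp only [SolSet, Set.mem_ofPred_eq]
  have : ∀ e, (∃ n : ℤ, y e - (α e - 1 * L e) = n) ↔ ∃ n : ℤ, y e - α e = n := by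
    intro e
    constructor
    · rintro ⟨n, hn⟩
      exact ⟨n - L e, by push_cast; linarith⟩
    · rintro ⟨n, hn⟩
      exact ⟨n + L e, by push_cast; linarith⟩
  simp only [this]

lemma recurrence {E : Finset (Sym2 V)} {L : Sym2 V → ℕ} (hL0 : ∀ e, e ∉ E → L e = 0)
    (hL2 : ∀ v : V, ∑ e with v ∈ e, (L e : ℚ) = 2) (α : Sym2 V → ℚ) :
    ∃ T : Finset ℚ, (∀ t ∈ T, 0 ≤ t ∧ t < 1) ∧ ∀ r : ℚ,
      (SolSet E α (r + 2)).ncard = (SolSet E α r).ncard +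
        ∑ t ∈ T, (ZSet E {e ∈ E | L e ≠ 0} (fun e => α e - t * L e) (r + 2 - 2 * t)).ncard := by
  classical
  set S : Finset (Sym2 V) := {e ∈ E | L e ≠ 0} with hS
  have hSL : ∀ e, e ∈ S ↔ L e ≠ 0 := by
    intro e
    simp only [hS, Finset.mem_filter, and_iff_right_iff_imp]
    intro h
    by_contra h'
    exact h (hL0 e h')
  refine ⟨(S.biUnion fun e => (Finset.range (L e)).image
    fun n : ℕ => (Int.fract (α e) + n) / L e), ?_, fun r => ?_⟩
  · intro t ht
    simp only [Finset.mem_biUnion, Finset.mem_image, Finset.mem_range] at ht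
    obtain ⟨e, he, n, hn, rfl⟩ := ht
    have hpos : (0 : ℚ) < L e := by
      have := (hSL e).1 he
      positivity
    have h1 := Int.fract_nonneg (α e)
    have h2 := Int.fract_lt_one (α e)
    refine ⟨by positivity, ?_⟩
    rw [div_lt_one hpos]
    have : (n : ℚ) + 1 ≤ L e := by exact_mod_cast hn
    linarith
  · set T := (S.biUnion fun e => (Finset.range (L e)).image
      fun n : ℕ => (Int.fract (α e) + n) / L e) with hT
    have hsplit : SolSet E α (r + 2) =
        {y | y ∈ SolSet E α (r + 2) ∧ (∀ e, 1 * (L e : ℚ) ≤ y e) ∧ True} ∪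
        ⋃ t ∈ T, {y | y ∈ SolSet E α (r + 2) ∧ (∀ e, t * L e ≤ y e) ∧
          ∃ e ∈ S, y e - t * L e = 0} := by
      ext y
      simp only [Set.mem_union, Set.mem_ofPred_eq, Set.mem_iUnion]
      constructor
      · intro hy
        by_cases hb : ∀ e, 1 * (L e : ℚ) ≤ y e
        · exact Or.inl ⟨hy, hb, trivial⟩
        · right
          push Not at hb
          obtain ⟨e0, he0⟩ := hb
          have hpos : ∀ e ∈ S, (0 : ℚ) < L e := by
            intro e he
            have := (hSL e).1 he
            positivity
          have he0S : e0 ∈ S := by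
            rw [hSL]
            intro h
            rw [h] at he0
            have := hy.1 e0
            simp at he0
            linarith
          obtain ⟨e1, he1, hmin⟩ := Finset.exists_min_image S (fun e => y e / L e) ⟨e0, he0S⟩
          have hp1 := hpos e1 he1
          have hlt : y e1 / L e1 < 1 := by
            refine lt_of_le_of_lt (hmin e0 he0S) ?_
            rw [div_lt_one (hpos e0 he0S)]
            simpa using he0
          have hlt' : y e1 < L e1 := by rwa [div_lt_one hp1] at hlt
          refine ⟨y e1 / L e1, ?_, hy, fun e => ?_, e1, he1, ?_⟩
          · simp only [hT, Finset.mem_biUnion, Finset.mem_image, Finset.mem_range]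
            have hf : 0 ≤ ⌊y e1⌋ := Int.floor_nonneg.2 (hy.1 e1)
            refine ⟨e1, he1, ⌊y e1⌋.toNat, ?_, ?_⟩
            · have : (⌊y e1⌋ : ℚ) < L e1 := (Int.floor_le _).trans_lt hlt'
              have : ⌊y e1⌋ < (L e1 : ℤ) := by exact_mod_cast this
              omega
            · congr 1
              obtain ⟨n, hn⟩ := hy.2.2.1 e1
              have h1 : Int.fract (α e1) = Int.fract (y e1) := by
                rw [show y e1 = α e1 + n by linarith, Int.fract_add_intCast]
              have h2 : ((⌊y e1⌋.toNat : ℕ) : ℚ) = ((⌊y e1⌋ : ℤ) : ℚ) := by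
                have : ((⌊y e1⌋.toNat : ℕ) : ℤ) = ⌊y e1⌋ := Int.toNat_of_nonneg hf
                exact_mod_cast this
              rw [h1, h2, Int.fract_add_floor]
          · by_cases he : e ∈ S
            · have := hmin e he
              rwa [le_div_iff₀ (hpos e he)] at this
            · have : L e = 0 := by
                by_contra h
                exact he ((hSL e).2 h)
              simp [this, hy.1 e]
          · field_simp
            ring
      · rintro (h | ⟨t, _, h⟩)
        · exact h.1
        · exact h.1
    have hTlt : ∀ t ∈ T, 0 ≤ t ∧ t < 1 := by
      intro t ht
      simp only [hT, Finset.mem_biUnion, Finset.mem_image, Finset.mem_range] at ht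
      obtain ⟨e, he, n, hn, rfl⟩ := ht
      have hpos : (0 : ℚ) < L e := by
        have := (hSL e).1 he
        positivity
      have h1 := Int.fract_nonneg (α e)
      have h2 := Int.fract_lt_one (α e)
      refine ⟨by positivity, ?_⟩
      rw [div_lt_one hpos]
      have : (n : ℚ) + 1 ≤ L e := by exact_mod_cast hn
      linarith
    have key : ∀ t t' : ℚ, t < t' → ∀ y : Sym2 V → ℚ,
        (∃ e ∈ S, y e - t * L e = 0) → (∀ e, t' * L e ≤ y e) → False := by
      rintro t t' htt y ⟨e, he, h⟩ h'
      have hpos : (0 : ℚ) < L e := by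
        have := (hSL e).1 he
        positivity
      have h1 := h' e
      have h2 : t * L e < t' * L e := mul_lt_mul_of_pos_right htt hpos
      linarith
    have hfin : ∀ (t : ℚ), {y | y ∈ SolSet E α (r + 2) ∧ (∀ e, t * L e ≤ y e) ∧
          ∃ e ∈ S, y e - t * L e = 0}.Finite := fun t =>
      (SolSet.finite E α (r + 2)).subset fun _ h => h.1
    rw [hsplit, Set.ncard_union_eq ?_ ?_ ?_]
    · congr 1
      · rw [shift_ncard hL0 hL2 α (r + 2) 1 zero_le_one (fun _ => True), SolSet_sub_int]
        simp
      · have hd : ∀ t ∈ T, ∀ t' ∈ T, t ≠ t' → Disjoint (hfin t).toFinset (hfin t').toFinset := by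
          intro t _ t' _ hne
          rw [Finset.disjoint_left]
          intro y h1 h2
          simp only [Set.Finite.mem_toFinset, Set.mem_ofPred_eq] at h1 h2
          rcases lt_or_gt_of_ne hne with h | h
          · exact key t t' h y h1.2.2 h2.2.1
          · exact key t' t h y h2.2.2 h1.2.1
        have h1 := Finset.card_biUnion hd
        have h2 : (⋃ t ∈ T, {y | y ∈ SolSet E α (r + 2) ∧ (∀ e, t * L e ≤ y e) ∧
          ∃ e ∈ S, y e - t * L e = 0}) = ((T.biUnion fun t => (hfin t).toFinset : Finset _) :
            Set (Sym2 V → ℚ)) := by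
          ext y
          simp
        rw [h2, Set.ncard_coe_finset, h1]
        refine Finset.sum_congr rfl fun t ht => ?_
        rw [← Set.ncard_eq_toFinset_card _ (hfin t)]
        exact shift_ncard hL0 hL2 α (r + 2) t (hTlt t ht).1 (fun y => ∃ e ∈ S, y e = 0)
    · rw [Set.disjoint_left]
      intro y h1 h2
      simp only [Set.mem_iUnion, Set.mem_ofPred_eq] at h1 h2
      obtain ⟨t, ht, h⟩ := h2
      exact key t 1 (hTlt t ht).2 y h.2.2 h1.2.1
    · exact (SolSet.finite E α (r + 2)).subset fun _ h => h.1
    · exact Set.Finite.biUnion T.finite_toSet fun t _ => hfin t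

lemma poly_of_factor {E : Finset (Sym2 V)} {L : Sym2 V → ℕ} (hL0 : ∀ e, e ∉ E → L e = 0)
    (hL2 : ∀ v : V, ∑ e with v ∈ e, (L e : ℚ) = 2)
    (hE : ∀ E', E' ⊂ E → GoodEdges E') (α : Sym2 V → ℚ) (ρ : ℚ) (hρ : 0 ≤ ρ) :
    PolySeq (fun k => ((SolSet E α (ρ + 2 * k)).ncard : ℚ)) := by
  obtain ⟨T, hT, hrec⟩ := recurrence hL0 hL2 α
  apply PolySeq.of_diff
  have : PolySeq (fun k => ∑ t ∈ T, ((ZSet E {e ∈ E | L e ≠ 0} (fun e => α e - t * L e)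
      ((ρ + 2 - 2 * t) + 2 * k)).ncard : ℚ)) := by
    refine PolySeq.sum T fun t ht => ?_
    exact zset_poly _ E (Finset.filter_subset _ _) hE _ _ (by linarith [(hT t ht).2])
  convert this using 2 with k
  have h := hrec (ρ + 2 * k)
  rw [show ρ + 2 * ((k + 1 : ℕ) : ℚ) = ρ + 2 * k + 2 by push_cast; ring, h]
  push_cast
  rw [add_sub_cancel_left]
  refine Finset.sum_congr rfl fun t _ => ?_
  rw [show ρ + 2 * (k : ℚ) + 2 - 2 * t = ρ + 2 - 2 * t + 2 * k by ring]

lemma goodEdges (E : Finset (Sym2 V)) : GoodEdges E := by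
  induction E using Finset.strongInduction with
  | H E ih =>
    intro α ρ hρ
    by_cases h : ∃ L : Sym2 V → ℕ, (∀ e, e ∉ E → L e = 0) ∧
      ∀ v : V, ∑ e with v ∈ e, (L e : ℚ) = 2
    · obtain ⟨L, h1, h2⟩ := h
      exact poly_of_factor h1 h2 ih α ρ hρ.le
    · have : ∀ k : ℕ, SolSet E α (ρ + 2 * k) = ∅ := by
        intro k
        rw [Set.eq_empty_iff_forall_notMem]
        intro y hy
        exact h (exists_two_factor (by positivity) hy)
      simpa [this] using PolySeq.zero

lemma sum_cast_eq {E : Finset (Sym2 V)} {L : Sym2 V → ℕ} (hL : ∀ e, e ∉ E → L e = 0) (v : V) :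
    ((∑ e ∈ E with v ∈ e, L e : ℕ) : ℚ) = ∑ e with v ∈ e, (L e : ℚ) := by
  push_cast
  refine Finset.sum_subset (Finset.filter_subset_filter _ (Finset.subset_univ _)) ?_
  intro e he he'
  have : e ∉ E := fun h => he' (by simp at he; simp [h, he])
  simp [hL e this]

lemma magic_mem {E : Finset (Sym2 V)} {L : Sym2 V → ℕ} {r : ℕ} (h : IsMagic E L r) :
    (fun e => (L e : ℚ)) ∈ SolSet E (fun _ => 0) (r : ℚ) := by
  obtain ⟨h1, h2⟩ := h
  refine ⟨fun e => by positivity, fun e he => by simp [h1 e he], fun e => ⟨L e, by simp⟩,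
    fun v => ?_⟩
  rw [← sum_cast_eq h1, h2 v]

lemma HG_eq (E : Finset (Sym2 V)) (r : ℕ) : HG E r = (SolSet E (fun _ => 0) (r : ℚ)).ncard := by
  unfold HG
  rw [show (SolSet E (fun _ => 0) (r : ℚ)).ncard = Nat.card (SolSet E (fun _ => 0) (r : ℚ)) from rfl]
  refine Nat.card_eq_of_bijective (fun L : {L : Sym2 V → ℕ // IsMagic E L r} =>
    (⟨fun e => (L.1 e : ℚ), ?_⟩ : SolSet E (fun _ => 0) (r : ℚ))) ⟨?_, ?_⟩
  · exact magic_mem L.2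
  · rintro ⟨L, hL⟩ ⟨L', hL'⟩ h
    simp only [Subtype.mk.injEq] at h ⊢
    ext e
    exact_mod_cast congrFun h e
  · rintro ⟨y, h0, h1, h2, h3⟩
    have : ∀ e, ∃ n : ℕ, y e = n := by
      intro e
      obtain ⟨n, hn⟩ := h2 e
      have hn' : y e = n := by simpa using hn
      have : 0 ≤ n := by
        have := h0 e
        rw [hn'] at this
        exact_mod_cast this
      obtain ⟨m, rfl⟩ := Int.eq_ofNat_of_zero_le this
      exact ⟨m, by simpa using hn'⟩
    choose L hL using this
    have hLE : ∀ e, e ∉ E → L e = 0 := fun e he => by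
      have := h1 e he
      rw [hL] at this
      exact_mod_cast this
    refine ⟨⟨L, hLE, fun v => ?_⟩, ?_⟩
    · have := sum_cast_eq hLE v
      simp only [← hL, h3] at this
      exact_mod_cast this
    · apply Subtype.ext
      ext e
      exact (hL e).symm

lemma HG_poly {E : Finset (Sym2 V)} (hpos : IsPositive E) (hne : E.Nonempty) :
    PolySeq (fun k => (HG E (2 * k) : ℚ)) ∧ PolySeq (fun k => (HG E (2 * k + 1) : ℚ)) := by
  obtain ⟨e, he⟩ := hne
  obtain ⟨L, r, hL, hLe⟩ := hpos e he
  have hr : 0 < r := by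
    induction e with
    | _ u v =>
      rw [← hL.2 u]
      refine lt_of_lt_of_le hLe (Finset.single_le_sum (f := L) (fun _ _ => Nat.zero_le _) ?_)
      simp [he]
  obtain ⟨M, hM0, hM2⟩ := exists_two_factor (by exact_mod_cast hr) (magic_mem hL)
  have key := poly_of_factor hM0 hM2 (fun E' _ => goodEdges E') (fun _ => 0)
  constructor
  · have := key 0 le_rfl
    simpa [HG_eq] using this
  · have := key 1 zero_le_one
    simp only [HG_eq]
    convert this using 5
    push_cast
    ring

/-- The incidence matrix (a loop counted once). -/
def incMat (E : Finset (Sym2 V)) : Matrix V E ℚ := fun v e => if v ∈ e.1 then 1 else 0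

lemma mem_ker_transpose {E : Finset (Sym2 V)} {w : V → ℚ} :
    w ∈ LinearMap.ker (incMat E).transpose.mulVecLin ↔
      ∀ u v, s(u, v) ∈ E → w u + w v = 0 := by
  have hval : ∀ u v, ∀ h : s(u, v) ∈ E, (incMat E).transpose.mulVec w ⟨s(u, v), h⟩ =
      if u = v then w u else w u + w v := by
    intro u v h
    simp only [Matrix.mulVec, dotProduct, Matrix.transpose_apply, incMat, Sym2.mem_iff, ite_mul,
      one_mul, zero_mul]
    rw [← Finset.sum_filter]
    split_ifs with huv
    · subst huv
      rw [Finset.sum_eq_single_of_mem u (by simp)]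
      intro b hb hne
      simp at hb
      exact absurd hb hne
    · have : (Finset.univ.filter (fun x => x = u ∨ x = v)) = {u, v} := by
        ext x
        simp
      rw [this, Finset.sum_pair huv]
  rw [LinearMap.mem_ker, Matrix.mulVecLin_apply]
  constructor
  · intro h u v huv
    have := congrFun h ⟨s(u, v), huv⟩
    rw [hval] at this
    simp only [Pi.zero_apply] at this
    split_ifs at this with h'
    · subst h'
      linarith
    · exact this
  · intro h
    ext ⟨e, he⟩
    induction e with
    | _ u v =>
      rw [hval]
      have := h u v he
      split_ifs with h'
      · subst h'
        simp only [Pi.zero_apply]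
        linarith
      · exact this

lemma compGraph_mk_eq {E : Finset (Sym2 V)} {u v : V} (h : s(u, v) ∈ E) :
    (compGraph E).connectedComponentMk u = (compGraph E).connectedComponentMk v := by
  by_cases huv : u = v
  · rw [huv]
  · refine SimpleGraph.ConnectedComponent.sound (SimpleGraph.Adj.reachable ?_)
    simp [compGraph, SimpleGraph.fromRel_adj, huv, h]

lemma const_on_comp {E : Finset (Sym2 V)} {β : Type*} (f : V → β)
    (C : (compGraph E).ConnectedComponent)
    (h : ∀ u v, s(u, v) ∈ E → (compGraph E).connectedComponentMk u = C → f u = f v) {u v : V}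
    (hu : (compGraph E).connectedComponentMk u = C)
    (hv : (compGraph E).connectedComponentMk v = C) : f u = f v := by
  have hr : (compGraph E).Reachable u v := SimpleGraph.ConnectedComponent.exact (hu.trans hv.symm)
  obtain ⟨p⟩ := hr
  induction p with
  | nil => rfl
  | @cons a b c hab p ih =>
    have hE : s(a, b) ∈ E := by
      simp only [compGraph, SimpleGraph.fromRel_adj] at hab
      rcases hab.2 with h | h
      · exact h
      · rwa [Sym2.eq_swap]
    have hb : (compGraph E).connectedComponentMk b = C := by rw [← compGraph_mk_eq hE, hu]
    rw [h a b hE hu]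
    exact ih hb hv

/-- sign of a colour -/
def sgnB (b : Bool) : ℚ := if b then 1 else -1

lemma sgnB_sq (b : Bool) : sgnB b * sgnB b = 1 := by cases b <;> simp [sgnB]

lemma sgnB_ne {a b : Bool} (h : a ≠ b) : sgnB a = - sgnB b := by
  cases a <;> cases b <;> simp_all [sgnB]

lemma finrank_ker_transpose (E : Finset (Sym2 V)) :
    Module.finrank ℚ (LinearMap.ker (incMat E).transpose.mulVecLin) = numBipComp E := by
  classical
  let Bip : (compGraph E).ConnectedComponent → Prop := fun C =>
    ∃ c : V → Bool, ∀ u v : V, s(u, v) ∈ E →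
      (compGraph E).connectedComponentMk u = C → c u ≠ c v
  have hB : numBipComp E = Nat.card {C // Bip C} := rfl
  have hcol : ∀ C : {C // Bip C}, ∃ c : V → Bool, ∀ u v : V, s(u, v) ∈ E →
      (compGraph E).connectedComponentMk u = C.1 → c u ≠ c v := fun C => C.2
  choose col hcol using hcol
  have hrep : ∀ C : (compGraph E).ConnectedComponent, ∃ v,
      (compGraph E).connectedComponentMk v = C := fun C => C.exists_rep
  choose rep hrep using hrep
  let K := LinearMap.ker (incMat E).transpose.mulVecLin
  let φ : K →ₗ[ℚ] ({C // Bip C} → ℚ) :=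
    { toFun := fun w C => w.1 (rep C.1) * sgnB (col C (rep C.1))
      map_add' := fun x y => by
        ext C
        simp [add_mul]
      map_smul' := fun a x => by
        ext C
        simp [mul_assoc] }
  have hconst : ∀ w ∈ K, ∀ C : {C // Bip C}, ∀ v, (compGraph E).connectedComponentMk v = C.1 →
      w v * sgnB (col C v) = w (rep C.1) * sgnB (col C (rep C.1)) := by
    intro w hw C v hv
    refine const_on_comp (fun v => w v * sgnB (col C v)) C.1 ?_ hv (hrep C.1)
    intro a b hab ha
    have h1 := mem_ker_transpose.1 hw a b hab
    rw [sgnB_ne (hcol C a b hab ha), show w a = - w b by linarith]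
    ring
  have hinj : Function.Injective φ := by
    rw [← LinearMap.ker_eq_bot, LinearMap.ker_eq_bot']
    rintro ⟨w, hw⟩ h0
    have hE := mem_ker_transpose.1 hw
    apply Subtype.ext
    ext v
    change w v = 0
    by_cases hb : Bip ((compGraph E).connectedComponentMk v)
    · have h1 := hconst w hw ⟨_, hb⟩ v rfl
      have h2 : w (rep _) * sgnB (col ⟨_, hb⟩ (rep _)) = 0 := congrFun h0 ⟨_, hb⟩
      rw [h2] at h1
      rcases mul_eq_zero.1 h1 with h | h
      · exact h
      · have := sgnB_sq (col ⟨_, hb⟩ v)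
        rw [h] at this
        norm_num at this
    · by_contra hne
      apply hb
      refine ⟨fun u => decide (0 < w u), fun a b hab ha => ?_⟩
      have habs : |w a| = |w v| := by
        refine const_on_comp (E := E) (fun v => |w v|) _ ?_ ha rfl
        intro x y hxy _
        rw [show w x = - w y by linarith [hE x y hxy], abs_neg]
      have hane : w a ≠ 0 := by
        intro h
        rw [h, abs_zero] at habs
        exact hne (abs_eq_zero.1 habs.symm)
      have h1 := hE a b hab
      rcases lt_or_gt_of_ne hane with h | h
      · have h2 : 0 < w b := by linarith
        simp [h2, h.le]
      · have h2 : w b ≤ 0 := by linarith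
        simp [h2, h]
  have hsurj : Function.Surjective φ := by
    intro f
    let w : V → ℚ := fun v => if h : Bip ((compGraph E).connectedComponentMk v) then
      f ⟨_, h⟩ * sgnB (col ⟨_, h⟩ v) else 0
    have hw' : ∀ C : {C // Bip C}, ∀ v, (compGraph E).connectedComponentMk v = C.1 →
        w v = f C * sgnB (col C v) := by
      rintro ⟨C, hC⟩ v rfl
      simp [w, hC]
    have hw : w ∈ K := by
      refine mem_ker_transpose.2 fun u v huv => ?_
      by_cases h : Bip ((compGraph E).connectedComponentMk u)
      · rw [hw' ⟨_, h⟩ u rfl, hw' ⟨_, h⟩ v (compGraph_mk_eq huv).symm,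
          sgnB_ne (hcol ⟨_, h⟩ u v huv rfl)]
        ring
      · have h' : ¬ Bip ((compGraph E).connectedComponentMk v) := by
          rwa [← compGraph_mk_eq huv]
        simp [w, h, h']
    refine ⟨⟨w, hw⟩, ?_⟩
    ext C
    change w (rep C.1) * sgnB (col C (rep C.1)) = f C
    rw [hw' C _ (hrep C.1), mul_assoc, sgnB_sq, mul_one]
  rw [(LinearEquiv.ofBijective φ ⟨hinj, hsurj⟩).finrank_eq, Module.finrank_pi, hB,
    Nat.card_eq_fintype_card]

lemma finrank_ker_inc (E : Finset (Sym2 V)) :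
    Module.finrank ℚ (LinearMap.ker (incMat E).mulVecLin) + Fintype.card V =
      E.card + numBipComp E := by
  have h1 := LinearMap.finrank_range_add_finrank_ker (incMat E).mulVecLin
  have h2 := LinearMap.finrank_range_add_finrank_ker (incMat E).transpose.mulVecLin
  have h3 := Matrix.rank_transpose (incMat E)
  rw [finrank_ker_transpose] at h2
  simp only [Matrix.rank] at h3
  simp only [Module.finrank_pi, Fintype.card_coe] at h1 h2
  omega

lemma inc_mulVec {E : Finset (Sym2 V)} (y : E → ℚ) (v : V) :
    (incMat E).mulVecLin y v = ∑ e : E with v ∈ e.1, y e := by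
  simp [Matrix.mulVec, dotProduct, incMat, Finset.sum_filter]

lemma sum_subtype_magic {E : Finset (Sym2 V)} (L : Sym2 V → ℕ) (v : V) :
    ∑ e : E with v ∈ e.1, (L e.1 : ℚ) = ((∑ e ∈ E with v ∈ e, L e : ℕ) : ℚ) := by
  push_cast
  rw [Finset.sum_filter, Finset.sum_filter, ← Finset.sum_coe_sort E]

lemma HG_upper (E : Finset (Sym2 V)) (r : ℕ) :
    HG E r ≤ (r + 1) ^ Module.finrank ℚ (LinearMap.ker (incMat E).mulVecLin) := by
  classical
  set K := LinearMap.ker (incMat E).mulVecLin with hK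
  let ev : E → Module.Dual ℚ K := fun e => (LinearMap.proj e).comp K.subtype
  obtain ⟨f, hf1, hf2, -⟩ := Submodule.exists_fun_fin_finrank_span_eq ℚ (Set.range ev)
  have hle : Module.finrank ℚ (Submodule.span ℚ (Set.range ev)) ≤ Module.finrank ℚ K := by
    rw [← Subspace.dual_finrank_eq (K := ℚ) (V := K)]
    exact Submodule.finrank_le _
  choose g hg using hf1
  have hbound : ∀ L : {L : Sym2 V → ℕ // IsMagic E L r}, ∀ e : E, L.1 e.1 < r + 1 := by
    intro L e
    have h1 := SolSet.le (magic_mem L.2) e.1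
    have : L.1 e.1 ≤ r := by exact_mod_cast h1
    omega
  let F : {L : Sym2 V → ℕ // IsMagic E L r} →
      (Fin (Module.finrank ℚ (Submodule.span ℚ (Set.range ev))) → Fin (r + 1)) :=
    fun L i => ⟨L.1 (g i).1, hbound L _⟩
  have hF : Function.Injective F := by
    intro L L' h
    let d : E → ℚ := fun e => (L.1 e.1 : ℚ) - L'.1 e.1
    have hd : d ∈ K := by
      rw [hK, LinearMap.mem_ker]
      ext v
      rw [inc_mulVec]
      simp only [d, Pi.zero_apply]
      rw [Finset.sum_sub_distrib, sum_subtype_magic, sum_subtype_magic, L.2.2 v, L'.2.2 v, sub_self]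
    have hz : ∀ φ ∈ Submodule.span ℚ (Set.range ev), φ ⟨d, hd⟩ = 0 := by
      intro φ hφ
      rw [← hf2] at hφ
      induction hφ using Submodule.span_induction with
      | mem x hx =>
        obtain ⟨i, rfl⟩ := hx
        rw [← hg i]
        have := congrArg Fin.val (congrFun h i)
        simp only [F] at this
        simp [ev, d, this]
      | zero => simp
      | add x y _ _ hx hy => simp [hx, hy]
      | smul a x _ hx => simp [hx]
    apply Subtype.ext
    ext e
    by_cases he : e ∈ E
    · have h1 := hz (ev ⟨e, he⟩) (Submodule.subset_span ⟨_, rfl⟩)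
      simp only [ev, LinearMap.comp_apply, Submodule.subtype_apply, LinearMap.proj_apply, d] at h1
      have : (L.1 e : ℚ) = L'.1 e := by linarith
      exact_mod_cast this
    · rw [L.2.1 e he, L'.2.1 e he]
  have h1 := Nat.card_le_card_of_injective F hF
  simp only [Nat.card_fun, Nat.card_fin] at h1
  exact h1.trans (Nat.pow_le_pow_right (by omega) hle)

lemma magic_finite (E : Finset (Sym2 V)) (r : ℕ) : Finite {L : Sym2 V → ℕ // IsMagic E L r} := by
  have : Finite (SolSet E (fun _ => 0) (r : ℚ)) := SolSet.finite _ _ _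
  refine Finite.of_injective (fun L : {L : Sym2 V → ℕ // IsMagic E L r} =>
    (⟨fun e => (L.1 e : ℚ), magic_mem L.2⟩ : SolSet E (fun _ => 0) (r : ℚ))) ?_
  rintro ⟨L, hL⟩ ⟨L', hL'⟩ h
  simp only [Subtype.mk.injEq] at h ⊢
  ext e
  exact_mod_cast congrFun h e

lemma exists_star {E : Finset (Sym2 V)} (hpos : IsPositive E) :
    ∃ (L : Sym2 V → ℕ) (s : ℕ), IsMagic E L s ∧ ∀ e ∈ E, 1 ≤ L e := by
  have h : ∀ e : E, ∃ (L : Sym2 V → ℕ) (r : ℕ), IsMagic E L r ∧ 0 < L e.1 := fun e => hpos e.1 e.2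
  choose L r hL hLe using h
  refine ⟨fun e => ∑ i : E, L i e, ∑ i : E, r i, ⟨fun e he => ?_, fun v => ?_⟩, fun e he => ?_⟩
  · exact Finset.sum_eq_zero fun i _ => (hL i).1 e he
  · rw [Finset.sum_comm]
    exact Finset.sum_congr rfl fun i _ => (hL i).2 v
  · exact (hLe ⟨e, he⟩).trans_le
      (Finset.single_le_sum (f := fun i : E => L i e) (fun _ _ => Nat.zero_le _)
        (Finset.mem_univ (⟨e, he⟩ : E)))

lemma exists_int_scale {ι : Type*} [Fintype ι] (f : ι → ℚ) :
    ∃ N : ℕ, 0 < N ∧ ∃ z : ι → ℤ, ∀ i, (z i : ℚ) = N * f i := by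
  classical
  refine ⟨∏ i, (f i).den, Finset.prod_pos fun i _ => (f i).den_pos,
    fun i => (∏ j ∈ Finset.univ.erase i, (f j).den : ℕ) * (f i).num, fun i => ?_⟩
  rw [← Finset.mul_prod_erase _ _ (Finset.mem_univ i)]
  push_cast
  have := Rat.mul_den_eq_num (f i)
  rw [← this]
  ring

lemma HG_lower {E : Finset (Sym2 V)} (hpos : IsPositive E) :
    ∃ R : ℕ, ∀ m : ℕ, (m + 1) ^ Module.finrank ℚ (LinearMap.ker (incMat E).mulVecLin) ≤
      HG E (2 * (R * m)) := by
  classical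
  set K := LinearMap.ker (incMat E).mulVecLin with hK
  obtain ⟨S, s, hS, hS1⟩ := exists_star hpos
  let b := Module.finBasis ℚ K
  obtain ⟨N, hN, z, hz⟩ := exists_int_scale (fun p : Fin (Module.finrank ℚ K) × E => (b p.1).1 p.2)
  let B : ℕ := ∑ e : E, ∑ i, (z (i, e)).natAbs
  have hB : ∀ e : E, ∑ i, |z (i, e)| ≤ (B : ℤ) := by
    intro e
    have h1 : ∑ i, (z (i, e)).natAbs ≤ B :=
      Finset.single_le_sum (f := fun e : E => ∑ i, (z (i, e)).natAbs)
        (fun _ _ => Nat.zero_le _) (Finset.mem_univ e)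
    have h2 : ((∑ i, (z (i, e)).natAbs : ℕ) : ℤ) = ∑ i, |z (i, e)| := by
      push_cast
      rfl
    rw [← h2]
    exact_mod_cast h1
  refine ⟨B * s, fun m => ?_⟩
  let val : (Fin (Module.finrank ℚ K) → Fin (m + 1)) → E → ℤ := fun c e =>
    2 * B * m * S e.1 + ∑ i, (c i : ℕ) * z (i, e)
  have hval : ∀ c e, 0 ≤ val c e := by
    intro c e
    have h1 : |∑ i, ((c i : ℕ) : ℤ) * z (i, e)| ≤ m * B := by
      calc |∑ i, ((c i : ℕ) : ℤ) * z (i, e)| ≤ ∑ i, |((c i : ℕ) : ℤ) * z (i, e)| :=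
            Finset.abs_sum_le_sum_abs _ _
        _ ≤ ∑ i, (m : ℤ) * |z (i, e)| := by
            refine Finset.sum_le_sum fun i _ => ?_
            rw [abs_mul]
            refine mul_le_mul_of_nonneg_right ?_ (abs_nonneg _)
            rw [abs_of_nonneg (by positivity)]
            have := (c i).2
            omega
        _ = m * ∑ i, |z (i, e)| := by rw [Finset.mul_sum]
        _ ≤ m * B := mul_le_mul_of_nonneg_left (hB e) (by positivity)
    have h2 := (abs_le.1 h1).1
    have h3 : (1 : ℤ) ≤ S e.1 := by exact_mod_cast hS1 e.1 e.2
    have h4 : (2 * B * m : ℤ) * 1 ≤ 2 * B * m * S e.1 :=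
      mul_le_mul_of_nonneg_left h3 (by positivity)
    have h5 : (0 : ℤ) ≤ m * B := by positivity
    simp only [val]
    nlinarith
  let lab : (Fin (Module.finrank ℚ K) → Fin (m + 1)) → Sym2 V → ℕ := fun c e =>
    if h : e ∈ E then (val c ⟨e, h⟩).toNat else 0
  have hlabQ : ∀ c (e : E), (lab c e.1 : ℚ) =
      2 * B * m * S e.1 + ∑ i, ((c i : ℕ) : ℚ) * (N * (b i).1 e) := by
    intro c e
    have h1 : (lab c e.1 : ℤ) = val c e := by
      simp [lab, e.2, hval c e]
    have h2 : (lab c e.1 : ℚ) = (val c e : ℚ) := by exact_mod_cast h1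
    rw [h2]
    simp only [val]
    push_cast
    simp only [hz]
  have hmag : ∀ c, IsMagic E (lab c) (2 * (B * s * m)) := by
    intro c
    refine ⟨fun e he => by simp [lab, he], fun v => ?_⟩
    have h1 := sum_subtype_magic (E := E) (lab c) v
    simp only [hlabQ] at h1
    rw [Finset.sum_add_distrib, ← Finset.mul_sum, sum_subtype_magic, hS.2 v, Finset.sum_comm] at h1
    have h2 : ∀ i, ∑ e : E with v ∈ e.1, ((c i : ℕ) : ℚ) * (N * (b i).1 e) = 0 := by
      intro i
      rw [← Finset.mul_sum, ← Finset.mul_sum, ← inc_mulVec]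
      have : (incMat E).mulVecLin (b i).1 = 0 := LinearMap.mem_ker.1 (b i).2
      rw [this]
      simp
    simp only [h2, Finset.sum_const_zero, add_zero] at h1
    have h3 : ((2 * (B * s * m) : ℕ) : ℚ) = ((∑ e ∈ E with v ∈ e, lab c e : ℕ) : ℚ) := by
      rw [← h1]
      push_cast
      ring
    exact_mod_cast h3.symm
  let F : (Fin (Module.finrank ℚ K) → Fin (m + 1)) →
      {L : Sym2 V → ℕ // IsMagic E L (2 * (B * s * m))} := fun c => ⟨lab c, hmag c⟩
  have hF : Function.Injective F := by
    intro c c' h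
    have h0 : lab c = lab c' := congrArg Subtype.val h
    have h1 : ∀ e : E, ∑ i, (((c i : ℕ) : ℚ) - ((c' i : ℕ) : ℚ)) * (b i).1 e = 0 := by
      intro e
      have h2 := hlabQ c e
      rw [h0, hlabQ c' e] at h2
      have h3 : (N : ℚ) * ∑ i, (((c i : ℕ) : ℚ) - ((c' i : ℕ) : ℚ)) * (b i).1 e = 0 := by
        rw [Finset.mul_sum]
        have h4 : ∀ i, (N : ℚ) * ((((c i : ℕ) : ℚ) - ((c' i : ℕ) : ℚ)) * (b i).1 e) =
          ((c i : ℕ) : ℚ) * (N * (b i).1 e) - ((c' i : ℕ) : ℚ) * (N * (b i).1 e) := fun i => by ring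
        simp only [h4]
        rw [Finset.sum_sub_distrib]
        linarith
      exact (mul_eq_zero.1 h3).resolve_left (by positivity)
    have h2 : ∑ i, (((c i : ℕ) : ℚ) - ((c' i : ℕ) : ℚ)) • b i = 0 := by
      apply Subtype.ext
      ext e
      simpa using h1 e
    have h3 := Fintype.linearIndependent_iff.1 b.linearIndependent _ h2
    ext i
    have h4 : ((c i : ℕ) : ℚ) = ((c' i : ℕ) : ℚ) := by linarith [h3 i]
    exact_mod_cast h4
  have := magic_finite E (2 * (B * s * m))
  have h1 := Nat.card_le_card_of_injective F hF
  simp only [Nat.card_fun, Nat.card_fin] at h1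
  exact h1

open Polynomial Filter in
lemma natDegree_le_of_bound (p q : Polynomial ℚ)
    (h : ∀ k : ℕ, |p.eval (k : ℚ)| ≤ |q.eval (k : ℚ)|) : p.natDegree ≤ q.natDegree := by
  by_contra! hlt
  let P : Polynomial ℝ := p.map (algebraMap ℚ ℝ)
  let Q : Polynomial ℝ := q.map (algebraMap ℚ ℝ)
  have hP : P.natDegree = p.natDegree := Polynomial.natDegree_map _
  have hQ : Q.natDegree = q.natDegree := Polynomial.natDegree_map _
  have hdeg : Q.degree < P.degree := by
    apply Polynomial.degree_lt_degree
    rw [hP, hQ]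
    exact hlt
  have hPQ := (Polynomial.isLittleO_atTop_of_degree_lt Q P hdeg).comp_tendsto
    (tendsto_natCast_atTop_atTop (R := ℝ))
  have hne : P ≠ 0 := by
    rintro h0
    rw [h0] at hdeg
    simp at hdeg
  have h1 := (hPQ.bound (c := 1 / 2) (by norm_num))
  have h2 := (tendsto_natCast_atTop_atTop (R := ℝ)).eventually
    (Polynomial.eventually_atTop_not_isRoot P hne)
  obtain ⟨k, hk1, hk2⟩ := (h1.and h2).exists
  have eP : P.eval (k : ℝ) = ((p.eval (k : ℚ) : ℚ) : ℝ) := by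
    simp only [P]
    rw [show (k : ℝ) = algebraMap ℚ ℝ (k : ℚ) by simp, Polynomial.eval_map_algebraMap,
      Polynomial.aeval_algebraMap_apply]
    simp
  have eQ : Q.eval (k : ℝ) = ((q.eval (k : ℚ) : ℚ) : ℝ) := by
    simp only [Q]
    rw [show (k : ℝ) = algebraMap ℚ ℝ (k : ℚ) by simp, Polynomial.eval_map_algebraMap,
      Polynomial.aeval_algebraMap_apply]
    simp
  have h3 : |P.eval (k : ℝ)| ≤ |Q.eval (k : ℝ)| := by
    rw [eP, eQ]
    exact_mod_cast h k
  simp only [Function.comp_apply, Real.norm_eq_abs] at hk1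
  have h4 : 0 < |P.eval (k : ℝ)| := abs_pos.2 hk2
  linarith

/-- Let `G` be a finite positive graph with at least one edge.  Then `H_G(r)` is a
quasi-polynomial `I(r) + (-1)^r J(r)` whose degree (the maximum of the degrees of
its two polynomial constituents) is `q - n + b`, where `q` is the number of edges,
`n` the number of vertices, and `b` the number of bipartite connected components
(the degree identity is stated additively to avoid natural subtraction). -/
theorem magic_quasipolynomial_degree (E : Finset (Sym2 V)) (hpos : IsPositive E)
    (hne : E.Nonempty) :
    ∃ I J : Polynomial ℚ,
      (∀ r : ℕ, (HG E r : ℚ) = I.eval (r : ℚ) + (-1) ^ r * J.eval (r : ℚ)) ∧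
      max I.natDegree J.natDegree + Fintype.card V = E.card + numBipComp E := by
  obtain ⟨⟨p, hp⟩, ⟨q, hq⟩⟩ := HG_poly hpos hne
  beta_reduce at hp hq
  set D := Module.finrank ℚ (LinearMap.ker (incMat E).mulVecLin) with hD
  have hDeq := finrank_ker_inc E
  rw [← hD] at hDeq
  have hup := HG_upper E
  rw [← hD] at hup
  have hpD : p.natDegree ≤ D := by
    refine (natDegree_le_of_bound p ((2 * Polynomial.X + 1) ^ D) fun k => ?_).trans ?_
    · rw [← hp k]
      have : (HG E (2 * k) : ℚ) ≤ (2 * k + 1) ^ D := by exact_mod_cast hup (2 * k)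
      simp only [Polynomial.eval_pow, Polynomial.eval_add, Polynomial.eval_mul, Polynomial.eval_X,
        Polynomial.eval_one, Polynomial.eval_ofNat]
      rw [abs_of_nonneg (by positivity), abs_of_nonneg (by positivity)]
      exact this
    · refine Polynomial.natDegree_pow_le.trans ?_
      have : (2 * Polynomial.X + 1 : Polynomial ℚ).natDegree ≤ 1 := by compute_degree
      nlinarith
  have hqD : q.natDegree ≤ D := by
    refine (natDegree_le_of_bound q ((2 * Polynomial.X + 2) ^ D) fun k => ?_).trans ?_
    · rw [← hq k]
      have : (HG E (2 * k + 1) : ℚ) ≤ (2 * k + 2) ^ D := by exact_mod_cast hup (2 * k + 1)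
      simp only [Polynomial.eval_pow, Polynomial.eval_add, Polynomial.eval_mul, Polynomial.eval_X,
        Polynomial.eval_ofNat]
      rw [abs_of_nonneg (by positivity), abs_of_nonneg (by positivity)]
      exact this
    · refine Polynomial.natDegree_pow_le.trans ?_
      have : (2 * Polynomial.X + 2 : Polynomial ℚ).natDegree ≤ 1 := by compute_degree
      nlinarith
  have hDp : D ≤ p.natDegree := by
    obtain ⟨R, hR⟩ := HG_lower hpos
    rw [← hD] at hR
    have h1 := natDegree_le_of_bound ((Polynomial.X + 1) ^ D)
      (p.comp (Polynomial.C (R : ℚ) * Polynomial.X)) (fun m => by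
        have h2 := hp (R * m)
        push_cast at h2
        simp only [Polynomial.eval_pow, Polynomial.eval_add, Polynomial.eval_mul,
          Polynomial.eval_X, Polynomial.eval_one, Polynomial.eval_comp, Polynomial.eval_C]
        rw [← h2, abs_of_nonneg (by positivity), abs_of_nonneg (by positivity)]
        exact_mod_cast hR m)
    rw [Polynomial.natDegree_pow, show (Polynomial.X + 1 : Polynomial ℚ).natDegree = 1 from
      Polynomial.natDegree_X_add_C (1 : ℚ), mul_one] at h1
    refine h1.trans (Polynomial.natDegree_comp_le.trans ?_)
    have : (Polynomial.C (R : ℚ) * Polynomial.X).natDegree ≤ 1 := by compute_degree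
    nlinarith
  let P : Polynomial ℚ := p.comp (Polynomial.C (1 / 2) * Polynomial.X)
  let Q : Polynomial ℚ := q.comp (Polynomial.C (1 / 2) * (Polynomial.X - 1))
  have hPdeg : P.natDegree ≤ D := by
    refine Polynomial.natDegree_comp_le.trans ?_
    have : (Polynomial.C (1 / 2 : ℚ) * Polynomial.X).natDegree ≤ 1 := by compute_degree
    nlinarith
  have hQdeg : Q.natDegree ≤ D := by
    refine Polynomial.natDegree_comp_le.trans ?_
    have : (Polynomial.C (1 / 2 : ℚ) * (Polynomial.X - 1)).natDegree ≤ 1 := by compute_degree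
    nlinarith
  have hPev : ∀ x, P.eval x = p.eval (x / 2) := fun x => by
    simp only [P, Polynomial.eval_comp, Polynomial.eval_mul, Polynomial.eval_C, Polynomial.eval_X]
    congr 1
    ring
  have hQev : ∀ x, Q.eval x = q.eval ((x - 1) / 2) := fun x => by
    simp only [Q, Polynomial.eval_comp, Polynomial.eval_mul, Polynomial.eval_C, Polynomial.eval_X,
      Polynomial.eval_sub, Polynomial.eval_one]
    congr 1
    ring
  refine ⟨Polynomial.C (1 / 2) * (P + Q), Polynomial.C (1 / 2) * (P - Q), fun r => ?_, ?_⟩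
  · simp only [Polynomial.eval_mul, Polynomial.eval_C, Polynomial.eval_add, Polynomial.eval_sub,
      hPev, hQev]
    rcases Nat.even_or_odd' r with ⟨k, rfl | rfl⟩
    · rw [hp k, pow_mul]
      push_cast
      rw [show (2 * (k : ℚ)) / 2 = k by ring]
      norm_num
      ring
    · rw [hq k, pow_succ, pow_mul]
      push_cast
      rw [show (2 * (k : ℚ) + 1 - 1) / 2 = k by ring]
      norm_num
      ring
  · rw [← hDeq]
    congr 1
    apply le_antisymm
    · refine max_le ?_ ?_
      · exact (Polynomial.natDegree_C_mul_le _ _).trans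
          ((Polynomial.natDegree_add_le _ _).trans (max_le hPdeg hQdeg))
      · exact (Polynomial.natDegree_C_mul_le _ _).trans
          ((Polynomial.natDegree_sub_le _ _).trans (max_le hPdeg hQdeg))
    · have hp' : p = (Polynomial.C (1 / 2) * (P + Q) + Polynomial.C (1 / 2) * (P - Q)).comp
          (Polynomial.C 2 * Polynomial.X) := by
        apply Polynomial.funext
        intro x
        simp only [Polynomial.eval_comp, Polynomial.eval_mul, Polynomial.eval_C,
          Polynomial.eval_add, Polynomial.eval_sub, Polynomial.eval_X, hPev]
        rw [show 2 * x / 2 = x by ring]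
        ring
      refine hDp.trans ?_
      conv_lhs => rw [hp']
      refine Polynomial.natDegree_comp_le.trans ?_
      have h1 : (Polynomial.C (2 : ℚ) * Polynomial.X).natDegree ≤ 1 := by compute_degree
      have h2 := Polynomial.natDegree_add_le (Polynomial.C (1 / 2) * (P + Q))
        (Polynomial.C (1 / 2) * (P - Q))
      exact (Nat.mul_le_mul h2 h1).trans (by rw [mul_one])
end

section
/- If D is a positive digraph with at least one edge, then H_D(r) agrees with a polynomial in r of degree q - 2n + b for all nonnegative integers r, where q is the number of edges of D, n is the number of vertices of D, and b is the number of connected components of the associated bipartite graph G_D. -/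
open Finset

variable {V : Type*} [Fintype V] [DecidableEq V]

/-- A magic labeling of the digraph with vertex set `V` and edge set `E ⊆ V × V`,
of magic sum `r`: for each vertex `v`, the sum of the labels of the edges with
initial vertex `v` equals `r` and the sum of the labels of the edges with
terminal vertex `v` equals `r`. -/
def IsMagicD (E : Finset (V × V)) (L : V × V → ℕ) (r : ℕ) : Prop :=
  (∀ e, e ∉ E → L e = 0) ∧ (∀ v : V, ∑ e ∈ E with e.1 = v, L e = r) ∧
    (∀ v : V, ∑ e ∈ E with e.2 = v, L e = r)

/-- `HD E r` is the number of magic labelings of the digraph of magic sum `r`. -/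
noncomputable def HD (E : Finset (V × V)) (r : ℕ) : ℕ :=
  Nat.card {L : V × V → ℕ // IsMagicD E L r}

/-- A positive digraph: for every edge `e` there is a magic labeling `L` of the
digraph with `L e > 0` (equivalently, the associated bipartite graph `G_D` is a
positive graph). -/
def IsPositiveD (E : Finset (V × V)) : Prop :=
  ∀ e ∈ E, ∃ (L : V × V → ℕ) (r : ℕ), IsMagicD E L r ∧ 0 < L e

/-- The edge set of the bipartite graph `G_D` associated to the digraph with edge
set `E`: vertex sets `A = Sum.inl '' V` and `B = Sum.inr '' V`, with an edge between
`a_i` and `b_j` iff `D` has an edge from `v_i` to `v_j`. -/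
def EGD (E : Finset (V × V)) : Finset (Sym2 (V ⊕ V)) :=
  E.image (fun p => s(Sum.inl p.1, Sum.inr p.2))

/-- The simple graph used to define the connected components of `G_D`. -/
def compGraphGD (E : Finset (V × V)) : SimpleGraph (V ⊕ V) :=
  SimpleGraph.fromRel (fun u v => s(u, v) ∈ EGD E)
lemma isMagicD_iff (E : Finset (V × V)) (L : V × V → ℕ) (r : ℕ) : IsMagicD E L r ↔
    (∀ e, e ∉ E → L e = 0) ∧ (∀ v : V, ∑ w, L (v, w) = r) ∧ (∀ w : V, ∑ v, L (v, w) = r) := by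
  unfold IsMagicD
  refine and_congr_right fun h => ?_
  have h1 : ∀ v, ∑ e ∈ E with e.1 = v, L e = ∑ w, L (v, w) := by
    intro v
    have : ∑ e ∈ E with e.1 = v, L e = ∑ e : V × V with e.1 = v, L e := by
      apply Finset.sum_subset
      · intro e; simp +contextual
      · intro e he he'
        apply h
        simp_all
    rw [this, Finset.sum_filter, Fintype.sum_prod_type, Finset.sum_eq_single v]
    · simp
    · intro b _ hb; simp [hb]
    · simp
  have h2 : ∀ v, ∑ e ∈ E with e.2 = v, L e = ∑ w, L (w, v) := by
    intro v
    have : ∑ e ∈ E with e.2 = v, L e = ∑ e : V × V with e.2 = v, L e := by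
      apply Finset.sum_subset
      · intro e; simp +contextual
      · intro e he he'
        apply h
        simp_all
    rw [this, Finset.sum_filter, Fintype.sum_prod_type_right, Finset.sum_eq_single v]
    · simp
    · intro b _ hb; simp [hb]
    · simp
  simp only [h1, h2]

lemma IsMagicD.le {E : Finset (V × V)} {L : V × V → ℕ} {r : ℕ} (h : IsMagicD E L r) (e : V × V) :
    L e ≤ r := by
  rw [isMagicD_iff] at h
  rw [← h.2.1 e.1]
  exact Finset.single_le_sum (f := fun w => L (e.1, w)) (fun _ _ => Nat.zero_le _)
    (Finset.mem_univ e.2)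

open Classical in
noncomputable def MM (E : Finset (V × V)) (r : ℕ) : Finset (V × V → ℕ) :=
  (Fintype.piFinset (fun _ => Finset.range (r + 1))).filter (fun L => IsMagicD E L r)

lemma mem_MM {E : Finset (V × V)} {r : ℕ} {L : V × V → ℕ} : L ∈ MM E r ↔ IsMagicD E L r := by
  unfold MM
  simp only [Finset.mem_filter, Fintype.mem_piFinset, Finset.mem_range, and_iff_right_iff_imp]
  intro h e
  have := h.le e
  omega

lemma HD_eq (E : Finset (V × V)) (r : ℕ) : HD E r = (MM E r).card := by
  unfold HD
  rw [← Nat.card_eq_finsetCard]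
  exact Nat.card_congr (Equiv.subtypeEquivRight fun L => mem_MM.symm)

lemma exists_sigma {E : Finset (V × V)} {L : V × V → ℕ} {r : ℕ} (h : IsMagicD E L r)
    (hr : 0 < r) : ∃ σ : Equiv.Perm V, ∀ v, (v, σ v) ∈ E := by
  have h0 := h
  rw [isMagicD_iff] at h
  obtain ⟨h1, h2, h3⟩ := h
  have key := (Finset.all_card_le_biUnion_card_iff_exists_injective
    (fun v : V => Finset.univ.filter (fun w => 0 < L (v, w)))).1 ?_
  · obtain ⟨f, hf, hf2⟩ := key
    refine ⟨Equiv.ofBijective f (Finite.injective_iff_bijective.1 hf), fun v => ?_⟩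
    by_contra hc
    have := hf2 v
    simp only [Equiv.ofBijective_apply] at hc
    simp [h1 _ hc] at this
  · intro S
    set N := S.biUnion (fun v : V => Finset.univ.filter (fun w => 0 < L (v, w))) with hN
    have e1 : S.card * r = ∑ v ∈ S, ∑ w ∈ N, L (v, w) := by
      rw [← smul_eq_mul, ← Finset.sum_const]
      refine Finset.sum_congr rfl fun v hv => ?_
      rw [← h2 v]
      symm
      apply Finset.sum_subset (Finset.subset_univ _)
      intro w _ hw
      by_contra hc
      apply hw
      rw [hN]
      simp only [Finset.mem_biUnion, Finset.mem_filter, Finset.mem_univ, true_and]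
      exact ⟨v, hv, Nat.pos_of_ne_zero hc⟩
    have e2 : ∑ v ∈ S, ∑ w ∈ N, L (v, w) ≤ N.card * r := by
      rw [Finset.sum_comm, ← smul_eq_mul, ← Finset.sum_const]
      refine Finset.sum_le_sum fun w _ => ?_
      rw [← h3 w]
      exact Finset.sum_le_sum_of_subset (Finset.subset_univ _)
    rw [← e1] at e2
    exact Nat.le_of_mul_le_mul_right e2 hr

lemma sum_poly (p : Polynomial ℚ) : ∃ Q : Polynomial ℚ, ∀ r : ℕ,
    ∑ s ∈ Finset.range (r + 1), p.eval (s : ℚ) = Q.eval (r : ℚ) := by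
  induction p using Polynomial.induction_on' with
  | add p q hp hq =>
    obtain ⟨P, hP⟩ := hp
    obtain ⟨Q, hQ⟩ := hq
    exact ⟨P + Q, fun r => by simp [Finset.sum_add_distrib, hP, hQ]⟩
  | monomial n a =>
    refine ⟨Polynomial.C a * ∑ i ∈ Finset.range (n + 1), Polynomial.C (bernoulli i *
      ((n + 1).choose i)) * (Polynomial.X + 1) ^ (n + 1 - i) * Polynomial.C (1 / ((n : ℚ) + 1)),
      fun r => ?_⟩
    have := sum_range_pow (r + 1) n
    simp only [Polynomial.eval_monomial]
    rw [← Finset.mul_sum, this]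
    simp only [Polynomial.eval_mul, Polynomial.eval_C, Polynomial.eval_finsetSum,
      Polynomial.eval_pow, Polynomial.eval_add, Polynomial.eval_X, Polynomial.eval_one]
    push_cast
    congr 1
    refine Finset.sum_congr rfl fun i _ => ?_
    ring

open Classical in
lemma MM_inter {E : Finset (V × V)} (σ : Equiv.Perm V) (s : ℕ) (t : Finset V) (ht : t.Nonempty) :
    t.inf' ht (fun v => (MM E s).filter (fun L => L (v, σ v) = 0)) =
      MM (E \ t.image (fun v => (v, σ v))) s := by
  ext L
  rw [Finset.mem_inf']
  simp only [Finset.mem_filter, mem_MM, isMagicD_iff]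
  constructor
  · intro h
    obtain ⟨v, hv⟩ := ht
    refine ⟨?_, (h v hv).1.2⟩
    intro e he
    by_cases heE : e ∈ E
    · simp only [Finset.mem_sdiff, heE, true_and, not_not, Finset.mem_image] at he
      obtain ⟨w, hw, rfl⟩ := he
      exact (h w hw).2
    · exact (h v hv).1.1 e heE
  · rintro ⟨h1, h2⟩ v hv
    refine ⟨⟨fun e he => h1 e ?_, h2⟩, h1 _ ?_⟩
    · simp [he]
    · simp only [Finset.mem_sdiff, not_and, not_not, Finset.mem_image]
      exact fun _ => ⟨v, hv, rfl⟩

def sg (σ : Equiv.Perm V) : V × V → ℕ := fun e => if e.2 = σ e.1 then 1 else 0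

lemma sg_magic {E : Finset (V × V)} {σ : Equiv.Perm V} (h : ∀ v, (v, σ v) ∈ E) :
    IsMagicD E (sg σ) 1 := by
  rw [isMagicD_iff]
  refine ⟨?_, ?_, ?_⟩
  · rintro ⟨a, b⟩ he
    unfold sg
    rw [if_neg]
    rintro h'
    simp only at h'
    subst h'
    exact he (h a)
  · intro v; simp [sg]
  · intro w
    have : ∀ v, (w = σ v) ↔ (v = σ.symm w) := fun v => by
      rw [Equiv.eq_symm_apply, eq_comm]
    simp [sg, this]

lemma IsMagicD.add {E : Finset (V × V)} {L M : V × V → ℕ} {r s : ℕ} (h : IsMagicD E L r)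
    (h' : IsMagicD E M s) : IsMagicD E (L + M) (r + s) := by
  unfold IsMagicD at *
  refine ⟨fun e he => ?_, fun v => ?_, fun v => ?_⟩
  · simp [h.1 e he, h'.1 e he]
  · simp [Finset.sum_add_distrib, h.2.1, h'.2.1]
  · simp [Finset.sum_add_distrib, h.2.2, h'.2.2]

lemma IsMagicD.of_add {E : Finset (V × V)} {L M : V × V → ℕ} {r s : ℕ}
    (h : IsMagicD E (L + M) (r + s))
    (h' : IsMagicD E M s) : IsMagicD E L r := by
  unfold IsMagicD at *
  simp only [Pi.add_apply, Finset.sum_add_distrib] at h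
  refine ⟨fun e he => ?_, fun v => ?_, fun v => ?_⟩
  · have := h.1 e he; omega
  · have := h.2.1 v; have := h'.2.1 v; omega
  · have := h.2.2 v; have := h'.2.2 v; omega

open Classical in
lemma card_step {E : Finset (V × V)} {σ : Equiv.Perm V} (h : ∀ v, (v, σ v) ∈ E) (r : ℕ) :
    (MM E (r + 1)).card = (MM E r).card +
      ((Finset.univ : Finset V).biUnion
        (fun v => (MM E (r + 1)).filter (fun L => L (v, σ v) = 0))).card := by
  have e1 : (MM E r).card = ((MM E r).image (fun L => L + sg σ)).card :=
    (Finset.card_image_of_injective _ (add_left_injective (sg σ))).symm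
  rw [e1, ← Finset.card_union_of_disjoint]
  · congr 1
    ext L
    simp only [Finset.mem_union, Finset.mem_image, Finset.mem_biUnion, Finset.mem_univ,
      true_and, Finset.mem_filter, mem_MM]
    constructor
    · intro hL
      by_cases hz : ∃ v, L (v, σ v) = 0
      · obtain ⟨v, hv⟩ := hz
        exact Or.inr ⟨v, hL, hv⟩
      · push Not at hz
        left
        have hs : L - sg σ + sg σ = L := by
          ext ⟨a, b⟩
          simp only [Pi.add_apply, Pi.sub_apply, sg]
          split_ifs with hb
          · subst hb; have := hz a; omega
          · simp
        refine ⟨L - sg σ, ?_, hs⟩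
        rw [← hs] at hL
        exact hL.of_add (sg_magic h)
    · rintro (⟨M, hM, rfl⟩ | ⟨v, hv, -⟩)
      · exact hM.add (sg_magic h)
      · exact hv
  · rw [Finset.disjoint_left]
    intro L hL hL'
    simp only [Finset.mem_image, Finset.mem_biUnion, Finset.mem_univ,
      true_and, Finset.mem_filter] at hL hL'
    obtain ⟨M, _, rfl⟩ := hL
    obtain ⟨v, _, hv⟩ := hL'
    simp [sg] at hv

lemma MM_zero (E : Finset (V × V)) : MM E 0 = {0} := by
  ext L
  rw [mem_MM, Finset.mem_singleton]
  constructor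
  · intro h
    ext e
    simpa using h.le e
  · rintro rfl
    simp [IsMagicD]

lemma good_of_sigma [Nonempty V] {E : Finset (V × V)} {σ : Equiv.Perm V} (h : ∀ v, (v, σ v) ∈ E)
    (ih : ∀ F ⊂ E, ∃ (p : Polynomial ℚ) (c : ℚ), ∀ r : ℕ,
      ((MM F r).card : ℚ) = p.eval (r : ℚ) + c * (if r = 0 then 1 else 0)) :
    ∃ p : Polynomial ℚ, ∀ r : ℕ, ((MM E r).card : ℚ) = p.eval (r : ℚ) := by
  classical
  have hsub : ∀ t : Finset V, t.Nonempty → E \ t.image (fun v => (v, σ v)) ⊂ E := by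
    rintro t ⟨v, hv⟩
    refine Finset.ssubset_iff_subset_ne.2 ⟨Finset.sdiff_subset, fun he => ?_⟩
    have := h v
    rw [← he] at this
    simp only [Finset.mem_sdiff, Finset.mem_image] at this
    exact this.2 ⟨v, hv, rfl⟩
  have ih' : ∀ t : Finset V, ∃ (p : Polynomial ℚ) (c : ℚ), t.Nonempty → ∀ r : ℕ,
      ((MM (E \ t.image (fun v => (v, σ v))) r).card : ℚ) =
        p.eval (r : ℚ) + c * (if r = 0 then 1 else 0) := by
    intro t
    by_cases ht : t.Nonempty
    · obtain ⟨p, c, hp⟩ := ih _ (hsub t ht)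
      exact ⟨p, c, fun _ => hp⟩
    · exact ⟨0, 0, fun h => absurd h ht⟩
  choose P c hP using ih'
  let g : ℕ → ℕ := fun s => ((Finset.univ : Finset V).biUnion
        (fun v => (MM E s).filter (fun L => L (v, σ v) = 0))).card
  let q : Polynomial ℚ := ∑ t : {t ∈ (Finset.univ : Finset V).powerset | t.Nonempty},
    Polynomial.C ((-1 : ℚ) ^ (t.1.card + 1)) * P t.1
  let d : ℚ := ∑ t : {t ∈ (Finset.univ : Finset V).powerset | t.Nonempty},
    ((-1 : ℚ) ^ (t.1.card + 1)) * c t.1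
  have hg : ∀ s, (g s : ℚ) = q.eval (s : ℚ) + d * (if s = 0 then 1 else 0) := by
    intro s
    have := Finset.inclusion_exclusion_card_biUnion (Finset.univ : Finset V)
        (fun v => (MM E s).filter (fun L => L (v, σ v) = 0))
    have h2 : (g s : ℚ) = ((g s : ℤ) : ℚ) := by simp
    rw [h2]
    simp only [g]
    rw [this]
    simp only [q, d, Polynomial.eval_finsetSum, Polynomial.eval_mul, Polynomial.eval_C]
    rw [Finset.sum_mul, ← Finset.sum_add_distrib]
    push_cast
    refine Finset.sum_congr rfl fun t _ => ?_
    have htne : t.1.Nonempty := (Finset.mem_filter.1 t.2).2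
    rw [MM_inter, hP t.1 htne]
    ring
  obtain ⟨Q, hQ⟩ := sum_poly q
  refine ⟨Q + Polynomial.C d, fun r => ?_⟩
  have hsum : (MM E r).card = ∑ s ∈ Finset.range (r + 1), g s := by
    induction r with
    | zero =>
      simp only [zero_add, Finset.sum_range_one, g]
      congr 1
      ext L
      simp only [MM_zero, Finset.mem_singleton, Finset.mem_biUnion, Finset.mem_univ, true_and,
        Finset.mem_filter]
      constructor
      · rintro rfl; exact ⟨Classical.arbitrary V, rfl, rfl⟩
      · rintro ⟨_, h, _⟩; exact h
    | succ r ihr =>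
      rw [Finset.sum_range_succ, ← ihr, card_step h]
  rw [hsum]
  push_cast
  simp only [hg, Finset.sum_add_distrib, hQ, Polynomial.eval_add, Polynomial.eval_C]
  congr 1
  rw [← Finset.mul_sum]
  simp

lemma good_all [Nonempty V] (E : Finset (V × V)) : ∃ (p : Polynomial ℚ) (c : ℚ), ∀ r : ℕ,
      ((MM E r).card : ℚ) = p.eval (r : ℚ) + c * (if r = 0 then 1 else 0) := by
  induction E using Finset.strongInduction with
  | H E ih =>
    by_cases hσ : ∃ σ : Equiv.Perm V, ∀ v, (v, σ v) ∈ E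
    · obtain ⟨σ, h⟩ := hσ
      obtain ⟨p, hp⟩ := good_of_sigma h ih
      exact ⟨p, 0, fun r => by simp [hp]⟩
    · refine ⟨0, 1, fun r => ?_⟩
      rcases Nat.eq_zero_or_pos r with rfl | hr
      · simp [MM_zero]
      · have : MM E r = ∅ := by
          rw [Finset.eq_empty_iff_forall_notMem]
          intro L hL
          exact hσ (exists_sigma (mem_MM.1 hL) hr)
        simp [this, hr.ne']

lemma natDegree_le_of_eval_le (P Q : Polynomial ℚ) (h0 : ∀ t : ℕ, 0 < P.eval (t : ℚ))
    (h : ∀ t : ℕ, P.eval (t : ℚ) ≤ Q.eval (t : ℚ)) : P.natDegree ≤ Q.natDegree := by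
  by_contra hc
  push Not at hc
  have h1 := Polynomial.div_tendsto_atTop_zero_of_degree_lt Q P (Polynomial.degree_lt_degree hc)
  have h2 := h1.comp (tendsto_natCast_atTop_atTop (R := ℚ))
  have h3 := ge_of_tendsto' (b := (1 : ℚ)) h2 (fun t => by
    simp only [Function.comp]
    rw [le_div_iff₀ (h0 t)]
    simpa using h t)
  norm_num at h3

lemma exists_coords {ι : Type*} [Fintype ι] (K : Submodule ℚ (ι → ℚ)) :
    ∃ m ≤ Module.finrank ℚ K, ∃ f : Fin m → ι, ∀ x ∈ K, (∀ i, x (f i) = 0) → x = 0 := by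
  let ev : ι → Module.Dual ℚ K := fun i => (LinearMap.proj i).comp K.subtype
  obtain ⟨f, hf, hs, -⟩ := Submodule.exists_fun_fin_finrank_span_eq ℚ (Set.range ev)
  refine ⟨_, ?_, fun i => (hf i).choose, ?_⟩
  · exact (Submodule.finrank_le _).trans_eq Subspace.dual_finrank_eq
  · intro x hx h
    have h2 : ∀ φ ∈ Submodule.span ℚ (Set.range f), φ ⟨x, hx⟩ = 0 := by
      intro φ hφ
      induction hφ using Submodule.span_induction with
      | mem y hy =>
        obtain ⟨i, rfl⟩ := hy
        rw [← (hf i).choose_spec]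
        exact h i
      | zero => rfl
      | add a b _ _ ha hb => simp [ha, hb]
      | smul a b _ hb => simp [hb]
    rw [hs] at h2
    ext i
    exact h2 (ev i) (Submodule.subset_span ⟨i, rfl⟩)

def BM (E : Finset (V × V)) : Matrix E (V ⊕ V) ℚ :=
  fun e x => Sum.elim (fun v => if e.1.1 = v then 1 else 0) (fun v => if e.1.2 = v then -1 else 0) x

lemma BM_mulVec (E : Finset (V × V)) (x : V ⊕ V → ℚ) (e : E) :
    (BM E).mulVec x e = x (Sum.inl e.1.1) - x (Sum.inr e.1.2) := by
  simp [Matrix.mulVec, dotProduct, BM, sub_eq_add_neg]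

lemma BM_magic (E : Finset (V × V)) (L : V × V → ℕ) (r : ℕ) : IsMagicD E L r ↔
    (∀ e, e ∉ E → L e = 0) ∧ (BM E).transpose.mulVec (fun e : E => (L e : ℚ)) =
      Sum.elim (fun _ => (r : ℚ)) (fun _ => -(r : ℚ)) := by
  unfold IsMagicD
  refine and_congr_right fun _ => ?_
  have h1 : ∀ v, (BM E).transpose.mulVec (fun e : E => (L e : ℚ)) (Sum.inl v) =
      ((∑ e ∈ E with e.1 = v, L e : ℕ) : ℚ) := by
    intro v
    rw [Finset.sum_filter, ← Finset.sum_coe_sort E]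
    simp [Matrix.mulVec, dotProduct, BM]
  have h2 : ∀ v, (BM E).transpose.mulVec (fun e : E => (L e : ℚ)) (Sum.inr v) =
      -((∑ e ∈ E with e.2 = v, L e : ℕ) : ℚ) := by
    intro v
    rw [Finset.sum_filter, ← Finset.sum_coe_sort E]
    simp [Matrix.mulVec, dotProduct, BM, ← Finset.sum_neg_distrib]
    refine Finset.sum_congr rfl fun e _ => ?_
    split_ifs <;> simp
  constructor
  · rintro ⟨ha, hb⟩
    ext x
    rcases x with v | v
    · rw [h1, ha]; rfl
    · rw [h2, hb]; rfl
  · intro h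
    constructor
    · intro v
      have := congrFun h (Sum.inl v)
      rw [h1] at this
      simp only [Sum.elim_inl] at this
      exact_mod_cast this
    · intro v
      have := congrFun h (Sum.inr v)
      rw [h2] at this
      simp only [Sum.elim_inr, neg_inj] at this
      exact_mod_cast this

noncomputable def KK (E : Finset (V × V)) : Submodule ℚ (E → ℚ) :=
  LinearMap.ker (BM E).transpose.mulVecLin

lemma adj_iff (E : Finset (V × V)) (e : V × V) (he : e ∈ E) :
    (compGraphGD E).Adj (Sum.inl e.1) (Sum.inr e.2) := by
  simp only [compGraphGD, SimpleGraph.fromRel_adj]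
  refine ⟨by simp, Or.inl ?_⟩
  exact Finset.mem_image.2 ⟨e, he, rfl⟩

lemma ker_const (E : Finset (V × V)) (x : V ⊕ V → ℚ) (hx : (BM E).mulVec x = 0) :
    ∀ u v, (compGraphGD E).Adj u v → x u = x v := by
  have key : ∀ u v, s(u, v) ∈ EGD E → x u = x v := by
    intro u v h
    obtain ⟨e, he, heq⟩ := Finset.mem_image.1 h
    have h1 := congrFun hx ⟨e, he⟩
    rw [BM_mulVec] at h1
    simp only [Pi.zero_apply, sub_eq_zero] at h1
    rcases Sym2.eq_iff.1 heq with ⟨rfl, rfl⟩ | ⟨rfl, rfl⟩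
    · exact h1
    · exact h1.symm
  intro u v h
  simp only [compGraphGD, SimpleGraph.fromRel_adj] at h
  rcases h.2 with h | h
  · exact key _ _ h
  · exact (key _ _ h).symm

lemma finrank_kerB (E : Finset (V × V)) :
    Module.finrank ℚ (LinearMap.ker (BM E).mulVecLin) =
      Nat.card (compGraphGD E).ConnectedComponent := by
  classical
  have : Fintype (compGraphGD E).ConnectedComponent := Fintype.ofFinite _
  let φ : ((compGraphGD E).ConnectedComponent → ℚ) →ₗ[ℚ] (V ⊕ V → ℚ) :=
    LinearMap.funLeft ℚ ℚ (compGraphGD E).connectedComponentMk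
  have hφ : Function.Injective φ :=
    LinearMap.funLeft_injective_of_surjective _ _ _ Quot.mk_surjective
  have hr : LinearMap.range φ = LinearMap.ker (BM E).mulVecLin := by
    ext x
    rw [LinearMap.mem_ker, Matrix.mulVecLin_apply]
    constructor
    · rintro ⟨y, rfl⟩
      ext e
      rw [BM_mulVec]
      simp only [φ, LinearMap.funLeft_apply, Pi.zero_apply, sub_eq_zero]
      congr 1
      exact SimpleGraph.ConnectedComponent.sound (adj_iff E e.1 e.2).reachable
    · intro hx
      have hc := ker_const E x hx
      have hre : ∀ u v, (compGraphGD E).Reachable u v → x u = x v := by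
        rintro u v ⟨w⟩
        induction w with
        | nil => rfl
        | cons h _ ih => exact (hc _ _ h).trans ih
      refine ⟨fun c => c.lift x (fun u v p _ => hre u v ⟨p⟩), ?_⟩
      ext u
      rfl
  rw [← hr, LinearMap.finrank_range_of_inj hφ, Module.finrank_fintype_fun_eq_card,
    Nat.card_eq_fintype_card]

lemma finrank_KK (E : Finset (V × V)) :
    Module.finrank ℚ (KK E) + 2 * Fintype.card V =
      E.card + Nat.card (compGraphGD E).ConnectedComponent := by
  have h1 := LinearMap.finrank_range_add_finrank_ker (BM E).mulVecLin
  have h2 := LinearMap.finrank_range_add_finrank_ker (BM E).transpose.mulVecLin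
  have h3 := Matrix.rank_transpose (BM E)
  rw [finrank_kerB] at h1
  simp only [Matrix.rank] at h3
  simp only [Module.finrank_fintype_fun_eq_card, Fintype.card_sum, Fintype.card_coe] at h1 h2
  unfold KK
  omega

lemma upper (E : Finset (V × V)) (r : ℕ) :
    (MM E r).card ≤ (r + 1) ^ Module.finrank ℚ (KK E) := by
  obtain ⟨m, hm, f, hf⟩ := exists_coords (KK E)
  refine le_trans ?_ (Nat.pow_le_pow_right (Nat.succ_pos r) hm)
  have : (Fintype.piFinset (fun _ : Fin m => Finset.range (r + 1))).card = (r + 1) ^ m := by simp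
  rw [← this]
  apply Finset.card_le_card_of_injOn (fun L i => L (f i).1)
  · intro L hL
    have hL := mem_MM.1 hL
    simp only [Finset.mem_coe, Fintype.mem_piFinset, Finset.mem_range]
    intro i
    have := hL.le (f i).1
    omega
  · intro L hL L' hL' heq
    have hL := (BM_magic _ _ _).1 (mem_MM.1 hL)
    have hL' := (BM_magic _ _ _).1 (mem_MM.1 hL')
    have := hf ((fun e : E => (L e : ℚ)) - (fun e : E => (L' e : ℚ))) ?_ ?_
    · ext e
      by_cases he : e ∈ E
      · have := congrFun this ⟨e, he⟩
        simp only [Pi.sub_apply, Pi.zero_apply, sub_eq_zero] at this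
        exact_mod_cast this
      · rw [hL.1 e he, hL'.1 e he]
    · rw [KK, LinearMap.mem_ker, map_sub, Matrix.mulVecLin_apply, Matrix.mulVecLin_apply,
        hL.2, hL'.2, sub_self]
    · intro i
      have := congrFun heq i
      simp only at this
      simp [this]

lemma exists_int_basis (E : Finset (V × V)) :
    ∃ k : Fin (Module.finrank ℚ (KK E)) → E → ℤ,
      (∀ i, (fun e => (k i e : ℚ)) ∈ KK E) ∧
      LinearIndependent ℚ (fun i => (fun e => (k i e : ℚ) : E → ℚ)) := by
  let b := Module.finBasis ℚ (KK E)
  obtain ⟨N, hN⟩ := IsLocalization.exist_integer_multiples (nonZeroDivisors ℤ)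
    (Finset.univ : Finset (Fin (Module.finrank ℚ (KK E)) × E)) (fun x => (b x.1 : E → ℚ) x.2)
  have hN' : ∀ i e, ∃ z : ℤ, (z : ℚ) = ((N : ℤ) : ℚ) * (b i : E → ℚ) e := by
    intro i e
    obtain ⟨z, hz⟩ := hN (i, e) (Finset.mem_univ _)
    refine ⟨z, ?_⟩
    simpa using hz
  choose k hk using hN'
  have hN0 : ((N : ℤ) : ℚ) ≠ 0 := by
    have := nonZeroDivisors.coe_ne_zero N
    exact_mod_cast this
  have hk' : ∀ i, (fun e => (k i e : ℚ)) = ((N : ℤ) : ℚ) • (b i : E → ℚ) := by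
    intro i; ext e; simp [hk]
  refine ⟨k, fun i => ?_, ?_⟩
  · rw [hk']
    exact (KK E).smul_mem _ (b i).2
  · have hfe : (fun i => (fun e => (k i e : ℚ) : E → ℚ)) =
        fun i => ((N : ℤ) : ℚ) • (b i : E → ℚ) := funext hk'
    rw [hfe]
    have h1 : LinearIndependent ℚ (fun i => (b i : E → ℚ)) :=
      b.linearIndependent.map' (KK E).subtype (Submodule.ker_subtype _)
    exact h1.units_smul (fun _ => Units.mk0 _ hN0)

lemma lower (E : Finset (V × V)) (L0 : V × V → ℕ) (r0 : ℕ) (h0 : IsMagicD E L0 r0)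
    (hp : ∀ e ∈ E, 0 < L0 e) : ∃ M : ℕ, 0 < M ∧ ∀ t : ℕ,
      (t + 1) ^ Module.finrank ℚ (KK E) ≤ (MM E (M * r0 * t)).card := by
  obtain ⟨k, hk, hli⟩ := exists_int_basis E
  let M : ℕ := 1 + ∑ e, ∑ i, (k i e).natAbs
  refine ⟨M, by simp [M], fun t => ?_⟩
  let Z : (Fin (Module.finrank ℚ (KK E)) → ℕ) → E → ℤ :=
    fun c e => (M * t * L0 e : ℕ) + ∑ i, (c i : ℤ) * k i e
  let LL : (Fin (Module.finrank ℚ (KK E)) → ℕ) → V × V → ℕ := fun c e =>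
    if h : e ∈ E then (Z c ⟨e, h⟩).toNat else 0
  have hZ : ∀ c, (∀ i, c i ≤ t) → ∀ e : E, (LL c e : ℤ) = Z c e := by
    intro c hc e
    simp only [LL, e.2, dite_true]
    rw [Int.toNat_of_nonneg]
    have a1 : |∑ i, (c i : ℤ) * k i e| ≤ t * ∑ i, ((k i e).natAbs : ℤ) := by
      refine (Finset.abs_sum_le_sum_abs _ _).trans ?_
      rw [Finset.mul_sum]
      refine Finset.sum_le_sum fun i _ => ?_
      rw [abs_mul, Int.natCast_natAbs, Nat.abs_cast]
      exact mul_le_mul_of_nonneg_right (by exact_mod_cast hc i) (abs_nonneg _)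
    have a2 : (∑ i, ((k i e).natAbs : ℤ)) ≤ M := by
      have : ∑ i, (k i e).natAbs ≤ ∑ e, ∑ i, (k i e).natAbs :=
        Finset.single_le_sum (f := fun e => ∑ i, (k i e).natAbs)
          (fun _ _ => Nat.zero_le _) (Finset.mem_univ e)
      have h' : ∑ i, (k i e).natAbs ≤ M := by simp only [M]; omega
      exact_mod_cast h'
    have a3 : (t : ℤ) * ∑ i, ((k i e).natAbs : ℤ) ≤ t * M :=
      mul_le_mul_of_nonneg_left a2 (by positivity)
    have a4 : (t * M : ℤ) ≤ (M * t * L0 e : ℕ) := by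
      have := Nat.mul_le_mul_left (M * t) (hp e.1 e.2)
      have h' : t * M ≤ M * t * L0 e := by linarith
      exact_mod_cast h'
    have := (abs_le.1 a1).1
    simp only [Z]
    linarith
  have hcard : (Fintype.piFinset (fun _ : Fin (Module.finrank ℚ (KK E)) =>
      Finset.range (t + 1))).card = (t + 1) ^ Module.finrank ℚ (KK E) := by simp
  have hQ : ∀ c, (∀ i, c i ≤ t) → (fun e : E => (LL c e : ℚ)) =
      ((M * t : ℕ) : ℚ) • (fun e : E => (L0 e : ℚ)) +
        ∑ i, (c i : ℚ) • (fun e => (k i e : ℚ)) := by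
    intro c hc
    ext e
    have := congrArg (fun z : ℤ => (z : ℚ)) (hZ c hc e)
    simp only [Z] at this
    push_cast at this
    simp [this]
  rw [← hcard]
  apply Finset.card_le_card_of_injOn LL
  · intro c hc
    have hc' : ∀ i, c i ≤ t := by
      simpa [Nat.lt_succ_iff] using hc
    rw [Finset.mem_coe, mem_MM, BM_magic]
    refine ⟨fun e he => by simp [LL, he], ?_⟩
    rw [hQ c hc', Matrix.mulVec_add, Matrix.mulVec_smul, ((BM_magic _ _ _).1 h0).2]
    have hz : (BM E).transpose.mulVec (∑ i, (c i : ℚ) • (fun e => (k i e : ℚ))) = 0 := by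
      have : (∑ i, (c i : ℚ) • (fun e => (k i e : ℚ))) ∈ KK E :=
        Submodule.sum_mem _ fun i _ => Submodule.smul_mem _ _ (hk i)
      simpa only [KK, LinearMap.mem_ker, Matrix.mulVecLin_apply] using this
    rw [hz, add_zero]
    ext x
    rcases x with v | v <;> simp <;> ring
  · intro c hc c' hc' heq
    have hc : ∀ i, c i ≤ t := by
      simpa [Nat.lt_succ_iff] using hc
    have hc' : ∀ i, c' i ≤ t := by
      simpa [Nat.lt_succ_iff] using hc'
    have h1 := hQ c hc
    rw [heq, hQ c' hc'] at h1
    have h2 := add_left_cancel h1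
    have h3 := Fintype.linearIndependent_iff.1 hli (fun i => (c' i : ℚ) - c i) (by
      simp only [sub_smul, Finset.sum_sub_distrib]
      rw [h2, sub_self])
    ext i
    have := h3 i
    rw [sub_eq_zero] at this
    exact_mod_cast this.symm

lemma exists_pos (E : Finset (V × V)) (hpos : IsPositiveD E) :
    ∃ L0 r0, IsMagicD E L0 r0 ∧ ∀ e ∈ E, 0 < L0 e := by
  have : ∀ F ⊆ E, ∃ L0 r0, IsMagicD E L0 r0 ∧ ∀ e ∈ F, 0 < L0 e := by
    intro F
    induction F using Finset.induction_on with
    | empty => exact fun _ => ⟨0, 0, by simp [IsMagicD], by simp⟩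
    | insert a F _ ih =>
      intro hF
      obtain ⟨L, r, h, h'⟩ := ih ((Finset.subset_insert _ _).trans hF)
      obtain ⟨L', r', g, g'⟩ := hpos a (hF (Finset.mem_insert_self _ _))
      refine ⟨L + L', r + r', h.add g, fun e he => ?_⟩
      rcases Finset.mem_insert.1 he with rfl | he
      · simp; omega
      · have := h' e he
        simp; omega
  exact this E subset_rfl

/-- If `D` is a positive digraph with at least one edge, then `H_D(r)` agrees with a
polynomial in `r` of degree `q - 2n + b` for all nonnegative integers `r`, where `q`
is the number of edges of `D`, `n` the number of vertices of `D`, and `b` the number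
of connected components of the associated bipartite graph `G_D` (the degree identity
is stated additively to avoid natural subtraction). -/
theorem digraph_magic_polynomial_degree (E : Finset (V × V)) (hpos : IsPositiveD E)
    (hne : E.Nonempty) :
    ∃ p : Polynomial ℚ,
      (∀ r : ℕ, (HD E r : ℚ) = p.eval (r : ℚ)) ∧
      p.natDegree + 2 * Fintype.card V =
        E.card + Nat.card (compGraphGD E).ConnectedComponent := by

  obtain ⟨e0, he0⟩ := hne
  have : Nonempty V := ⟨e0.1⟩
  obtain ⟨L0, r0, h0, hp⟩ := exists_pos E hpos
  have hr0 : 0 < r0 := lt_of_lt_of_le (hp e0 he0) (h0.le e0)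
  obtain ⟨σ, hσ⟩ := exists_sigma h0 hr0
  obtain ⟨p, hpe⟩ := good_of_sigma hσ (fun F _ => good_all F)
  refine ⟨p, fun r => by rw [HD_eq, hpe], ?_⟩
  rw [← finrank_KK]
  congr 1
  have hX : ∀ d, ((Polynomial.X + 1 : Polynomial ℚ) ^ d).natDegree = d := by
    intro d
    rw [Polynomial.natDegree_pow, ← Polynomial.C_1, Polynomial.natDegree_X_add_C, mul_one]
  have hpos1 : ∀ r, 0 < (MM E r).card := by
    intro r
    induction r with
    | zero => simp [MM_zero]
    | succ r ih => rw [card_step hσ]; omega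
  apply le_antisymm
  · rw [← hX (Module.finrank ℚ (KK E))]
    apply natDegree_le_of_eval_le
    · intro t
      rw [← hpe]
      exact_mod_cast hpos1 t
    · intro t
      rw [← hpe]
      simp only [Polynomial.eval_pow, Polynomial.eval_add, Polynomial.eval_X, Polynomial.eval_one]
      exact_mod_cast upper E t
  · obtain ⟨M, hM, hl⟩ := lower E L0 r0 h0 hp
    have hne0 : ((M * r0 : ℕ) : ℚ) ≠ 0 := by
      have : M * r0 ≠ 0 := (Nat.mul_pos hM hr0).ne'
      exact_mod_cast this
    have hcomp : (p.comp (Polynomial.C ((M * r0 : ℕ) : ℚ) * Polynomial.X)).natDegree =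
        p.natDegree := by
      rw [Polynomial.natDegree_comp, Polynomial.natDegree_C_mul_X _ hne0, mul_one]
    rw [← hcomp]
    conv_lhs => rw [← hX (Module.finrank ℚ (KK E))]
    apply natDegree_le_of_eval_le
    · intro t
      simp only [Polynomial.eval_pow, Polynomial.eval_add, Polynomial.eval_X, Polynomial.eval_one]
      positivity
    · intro t
      have h1 := hpe (M * r0 * t)
      rw [Nat.cast_mul] at h1
      simp only [Polynomial.eval_pow, Polynomial.eval_add, Polynomial.eval_X, Polynomial.eval_one,
        Polynomial.eval_comp, Polynomial.eval_mul, Polynomial.eval_C]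
      rw [← h1]
      exact_mod_cast hl t
end
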